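/- arXiv:2511.12505 — 6 statements merged into one kernel-verified Lean document; each statement's English description precedes it below -/
import Mathlib

section
/- For every integer s ≥ 1, the exponent 2 - 1/s is star realisable: there exists a graph H and constants c_1, c_2 > 0 such that for all sufficiently large n, c_1·n^{2-1/s} ≤ ar*(n, H) ≤ c_2·n^{2-1/s}. -/
open SimpleGraph

/-- An edge-colouring of the complete graph on `α` (only values on
non-diagonal pairs are relevant). -/
abbrev EdgeColouring (α : Type*) := Sym2 α → ℕ

/-- A star-colouring: every colour class is a star, i.e. any two edges of the
same colour share a vertex, and no colour class contains a triangle. -/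
def IsStarColouring {α : Type*} (c : EdgeColouring α) : Prop :=
  (∀ a b x y : α, a ≠ b → x ≠ y → c s(a, b) = c s(x, y) →
      a = x ∨ a = y ∨ b = x ∨ b = y) ∧
  ∀ a b d : α, a ≠ b → b ≠ d → a ≠ d →
      ¬(c s(a, b) = c s(b, d) ∧ c s(b, d) = c s(a, d))

/-- The number of colours used on the edges of the complete graph on `α`. -/
noncomputable def colourCount {α : Type*} (c : EdgeColouring α) : ℕ :=
  (c '' {e : Sym2 α | ¬ e.IsDiag}).ncard

/-- The colouring `c` of the complete graph on `α` contains a rainbow copy of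
the graph `H`: there is an injection of `V(H)` such that distinct edges of `H`
receive distinct colours. -/
def HasRainbowCopy {α β : Type*} (c : EdgeColouring α) (H : SimpleGraph β) : Prop :=
  ∃ f : β ↪ α, ∀ u v x y : β, H.Adj u v → H.Adj x y → s(u, v) ≠ s(x, y) →
    c s(f u, f v) ≠ c s(f x, f y)

/-- The star-anti-Ramsey number `ar*(n, H)`: the maximum number of colours in a
star-colouring of `K_n` with no rainbow copy of `H`. -/
noncomputable def starAntiRamsey (n : ℕ) {β : Type*} (H : SimpleGraph β) : ℕ :=
  sSup {s | ∃ c : EdgeColouring (Fin n), IsStarColouring c ∧ colourCount c = s ∧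
    ¬ HasRainbowCopy c H}

/-- The lexical colouring of `K_n`: the edge `{i, j}` with `i < j` gets colour `i`. -/
def lexColouring (n : ℕ) : EdgeColouring (Fin n) :=
  Sym2.lift ⟨fun i j => min i.1 j.1, fun i j => by simp [min_comm]⟩

/-- `c` is a lexical colouring with respect to some ordering of the vertices. -/
def IsLexical {n : ℕ} (c : EdgeColouring (Fin n)) : Prop :=
  ∃ v : Fin n ≃ Fin n, ∀ i j i' j' : Fin n, i < j → i' < j' →
    (c s(v i, v j) = c s(v i', v j') ↔ i = i')

/-- `v` is a centre of the colour class of colour `m`: the class is nonempty and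
every edge of colour `m` is incident to `v` (for star-colourings this is exactly
a vertex of maximum degree in the class). -/
def IsCentre {α : Type*} (c : EdgeColouring α) (v : α) (m : ℕ) : Prop :=
  (∃ e : Sym2 α, ¬ e.IsDiag ∧ c e = m ∧ v ∈ e) ∧
  ∀ e : Sym2 α, ¬ e.IsDiag → c e = m → v ∈ e

/-- `G` contains a copy of `F` as a subgraph. -/
def ContainsCopy {α β : Type*} (F : SimpleGraph α) (G : SimpleGraph β) : Prop :=
  ∃ f : α ↪ β, ∀ u v, F.Adj u v → G.Adj (f u) (f v)

/-- The extremal (Turán) number `ex(n, F)`. -/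
noncomputable def extremalNumber (n : ℕ) {α : Type*} (F : SimpleGraph α) : ℕ :=
  sSup {m | ∃ G : SimpleGraph (Fin n), ¬ ContainsCopy F G ∧ G.edgeSet.ncard = m}

/-- The join of two graphs: vertex-disjoint copies of `G` and `H` together with
all edges between them. -/
def graphJoin {α β : Type*} (G : SimpleGraph α) (H : SimpleGraph β) :
    SimpleGraph (α ⊕ β) :=
  SimpleGraph.fromRel (fun x y => match x, y with
    | Sum.inl a, Sum.inl b => G.Adj a b
    | Sum.inr a, Sum.inr b => H.Adj a b
    | Sum.inl _, Sum.inr _ => True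
    | Sum.inr _, Sum.inl _ => False)

/-- The complete bipartite graph `K_{s,t}` minus one edge. -/
def Kstminus (s t : ℕ) (hs : 0 < s) (ht : 0 < t) : SimpleGraph (Fin s ⊕ Fin t) :=
  (completeBipartiteGraph (Fin s) (Fin t)).deleteEdges
    {s(Sum.inl ⟨0, hs⟩, Sum.inr ⟨0, ht⟩)}

section Elimination

open Polynomial

variable {K A ι : Type*} [Field K] [CommRing A] [Algebra K A]

/-- The values at `z` of the polynomials over `K` of degree less than `d`. -/
noncomputable def polySpan (K : Type*) {A : Type*} [Field K] [CommRing A] [Algebra K A]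
    (z : A) (d : ℕ) : Submodule K A :=
  (degreeLT K d).map (aeval z).toLinearMap

/-- The span of the monomials in `y 0, …, y (m - 1)` whose degree in `y i` is at most `i + k`. -/
noncomputable def monoSpan (K : Type*) {A : Type*} [Field K] [CommRing A] [Algebra K A]
    (y : ℕ → A) (k m : ℕ) : Submodule K A :=
  ∏ i ∈ Finset.range m, polySpan K (y i) (i + 1 + k)

/-- The product of the differences `y i - a i j` over `i < m`. -/
def diffProd (y : ℕ → A) (a : ℕ → ι → K) (m : ℕ) (j : ι) : A :=
  ∏ i ∈ Finset.range m, (y i - algebraMap K A (a i j))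

lemma aeval_mem_polySpan (z : A) {d : ℕ} {p : K[X]} (hp : p.degree < d) :
    aeval z p ∈ polySpan K z d :=
  ⟨p, mem_degreeLT.2 hp, rfl⟩

lemma polySpan_mono (z : A) {d e : ℕ} (h : d ≤ e) : polySpan K z d ≤ polySpan K z e :=
  Submodule.map_mono (degreeLT_mono h)

lemma monoSpan_succ (y : ℕ → A) (k m : ℕ) :
    monoSpan K y k (m + 1) = monoSpan K y k m * polySpan K (y m) (m + 1 + k) :=
  Finset.prod_range_succ _ _

lemma diffProd_succ (y : ℕ → A) (a : ℕ → ι → K) (m : ℕ) (j : ι) :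
    diffProd y a (m + 1) j = diffProd y a m j * (y m - algebraMap K A (a m j)) :=
  Finset.prod_range_succ _ _

lemma monoSpan_mono (y : ℕ → A) {k l : ℕ} (h : k ≤ l) (m : ℕ) :
    monoSpan K y k m ≤ monoSpan K y l m := by
  induction m with
  | zero => simp [monoSpan]
  | succ m ih =>
    rw [monoSpan_succ, monoSpan_succ]
    exact mul_le_mul' ih (polySpan_mono _ (by omega))

lemma one_mem_monoSpan (y : ℕ → A) (k m : ℕ) : (1 : A) ∈ monoSpan K y k m := by
  induction m with
  | zero => exact Submodule.one_le.1 (by simp [monoSpan])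
  | succ m ih =>
    rw [monoSpan_succ]
    have h : (1 : A) ∈ polySpan K (y m) (m + 1 + k) := by
      have := aeval_mem_polySpan (K := K) (y m) (d := m + 1 + k) (p := 1)
        (by rw [degree_one]; exact_mod_cast (by omega : 0 < m + 1 + k))
      simpa using this
    simpa using Submodule.mul_mem_mul ih h

lemma exists_polySpan_eq_span (z : A) (d : ℕ) :
    ∃ S : Finset A, S.card ≤ d ∧ polySpan K z d = Submodule.span K (S : Set A) := by
  classical
  refine ⟨((Finset.range d).image fun n => (X ^ n : K[X])).image (aeval z), ?_, ?_⟩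
  · exact (Finset.card_image_le.trans Finset.card_image_le).trans (by simp)
  · rw [polySpan, degreeLT_eq_span_X_pow, Submodule.map_span,
      Finset.coe_image (s := Finset.image _ _)]
    rfl

lemma exists_monoSpan_eq_span (y : ℕ → A) (m : ℕ) :
    ∃ S : Finset A, S.card ≤ m.factorial ∧ monoSpan K y 0 m = Submodule.span K (S : Set A) := by
  classical
  open Pointwise in
  induction m with
  | zero => exact ⟨{1}, by simp, by simp [monoSpan, Submodule.one_eq_span]⟩
  | succ m ih =>
    obtain ⟨S, hS, hS'⟩ := ih
    obtain ⟨T, hT, hT'⟩ := exists_polySpan_eq_span (K := K) (y m) (m + 1)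
    refine ⟨S * T, ?_, ?_⟩
    · rw [Nat.factorial_succ, mul_comm (m + 1)]
      exact Finset.card_mul_le.trans (Nat.mul_le_mul hS hT)
    · rw [monoSpan_succ, hS', add_zero, hT', Submodule.span_mul_span, Finset.coe_mul]

lemma degree_prod_X_sub_C (J : Finset ι) (v : ι → K) :
    (∏ j ∈ J, (X - C (v j))).degree = (J.card : WithBot ℕ) := by
  simp [degree_prod]

variable [DecidableEq ι]

/-- Multihomogeneous elimination: the multiples of the forms `diffProd y a m j` exhaust
all monomials of slightly larger multidegree. -/
lemma monoSpan_one_le (y : ℕ → A) (a : ℕ → ι → K) (m : ℕ) :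
    ∀ J : Finset ι, J.card = m + 1 → (∀ i < m, Set.InjOn (a i) J) →
      monoSpan K y 1 m ≤
        ⨆ j ∈ J, Submodule.span K {diffProd y a m j} * monoSpan K y 0 m := by
  induction m with
  | zero =>
    intro J hJ _
    obtain ⟨j, rfl⟩ := Finset.card_eq_one.1 hJ
    simp [monoSpan, diffProd, ← Submodule.one_eq_span]
  | succ m ih =>
    intro J hJ ha
    set Y := ⨆ j ∈ J, Submodule.span K {diffProd y a (m + 1) j} * monoSpan K y 0 (m + 1)
    have key : ∀ k ∈ J, ∀ f ∈ monoSpan K y 1 m,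
        f * aeval (y m) (∏ j ∈ J.erase k, (X - C (a m j))) ∈ Y := by
      intro k hk f hf
      have hle := ih (J.erase k) (by rw [Finset.card_erase_of_mem hk]; omega)
        (fun i hi => (ha i (by omega)).mono (Finset.coe_subset.2 (Finset.erase_subset _ _)))
      have h2 : (⨆ j ∈ J.erase k, Submodule.span K {diffProd y a m j} * monoSpan K y 0 m) ≤
          Y.comap (LinearMap.mulRight K
            (aeval (y m) (∏ j ∈ J.erase k, (X - C (a m j))))) := by
        refine iSup₂_le fun j hj x hx => ?_
        obtain ⟨g, hg, rfl⟩ := Submodule.mem_span_singleton_mul.1 hx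
        rw [Submodule.mem_comap, LinearMap.mulRight_apply]
        refine Submodule.mem_iSup_of_mem j (Submodule.mem_iSup_of_mem (Finset.mem_of_mem_erase hj)
          (Submodule.mem_span_singleton_mul.2
            ⟨g * aeval (y m) (∏ l ∈ (J.erase k).erase j, (X - C (a m l))), ?_, ?_⟩))
        · rw [monoSpan_succ]
          refine Submodule.mul_mem_mul hg (aeval_mem_polySpan _ ?_)
          rw [degree_prod_X_sub_C, Finset.card_erase_of_mem hj, Finset.card_erase_of_mem hk, hJ]
          exact_mod_cast (by omega : m + 1 + 1 - 1 - 1 < m + 1 + 0)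
        · rw [diffProd_succ, ← Finset.mul_prod_erase _ _ hj]
          simp only [map_mul, map_sub, aeval_X, aeval_C]
          ring
      exact h2 (hle hf)
    rw [monoSpan_succ, Submodule.mul_le]
    rintro f hf _ ⟨p, hp, rfl⟩
    have hp' : p.degree < J.card := by
      rw [hJ]; exact mem_degreeLT.1 hp
    rw [Lagrange.eq_interpolate (ha m (by omega)) hp', Lagrange.interpolate_eq_sum]
    simp only [AlgHom.toLinearMap_apply, map_sum, map_mul, Finset.mul_sum, aeval_C]
    refine Submodule.sum_mem _ fun k hk => ?_
    rw [mul_left_comm, ← Algebra.smul_def]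
    exact Y.smul_mem _ (key k hk f hf)

/-- If `diffProd y a (m + 1) j` is a scalar for `m + 1` values of `j`, then the span of the
monomials is stable under multiplication by the last variable. -/
lemma mul_mem_monoSpan (y : ℕ → A) (a : ℕ → ι → K) (m : ℕ) (J : Finset ι) (hJ : J.card = m + 1)
    (ha : ∀ i < m, Set.InjOn (a i) J) (b : ι → K)
    (hb : ∀ j ∈ J, diffProd y a (m + 1) j = algebraMap K A (b j))
    {u : A} (hu : u ∈ monoSpan K y 0 (m + 1)) : y m * u ∈ monoSpan K y 0 (m + 1) := by
  have h1 : ∀ f ∈ monoSpan K y 0 m,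
      f * aeval (y m) (∏ j ∈ J, (X - C (a m j))) ∈ monoSpan K y 0 (m + 1) := by
    intro f hf
    have h2 : (⨆ j ∈ J, Submodule.span K {diffProd y a m j} * monoSpan K y 0 m) ≤
        (monoSpan K y 0 (m + 1)).comap (LinearMap.mulRight K
          (aeval (y m) (∏ j ∈ J, (X - C (a m j))))) := by
      refine iSup₂_le fun j hj x hx => ?_
      obtain ⟨g, hg, rfl⟩ := Submodule.mem_span_singleton_mul.1 hx
      rw [Submodule.mem_comap, LinearMap.mulRight_apply]
      have h3 : diffProd y a m j * g * aeval (y m) (∏ j ∈ J, (X - C (a m j))) =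
          b j • (g * aeval (y m) (∏ l ∈ J.erase j, (X - C (a m l)))) := by
        rw [Algebra.smul_def, ← hb j hj, diffProd_succ, ← Finset.mul_prod_erase _ _ hj]
        simp only [map_mul, map_sub, aeval_X, aeval_C]
        ring
      rw [h3, monoSpan_succ]
      refine Submodule.smul_mem _ _ (Submodule.mul_mem_mul hg (aeval_mem_polySpan _ ?_))
      rw [degree_prod_X_sub_C, Finset.card_erase_of_mem hj, hJ]
      exact_mod_cast (by omega : m + 1 - 1 < m + 1 + 0)
    exact h2 (monoSpan_one_le y a m J hJ ha (monoSpan_mono y zero_le_one m hf))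
  have h4 : monoSpan K y 0 (m + 1) ≤
      (monoSpan K y 0 (m + 1)).comap (LinearMap.mulLeft K (y m)) := by
    conv_lhs => rw [monoSpan_succ]
    rw [Submodule.mul_le]
    rintro f hf _ ⟨p, hp, rfl⟩
    rw [Submodule.mem_comap, LinearMap.mulLeft_apply, AlgHom.toLinearMap_apply]
    set N : K[X] := ∏ j ∈ J, (X - C (a m j)) with hN
    have hNm : N.Monic := monic_prod_of_monic _ _ fun j _ => monic_X_sub_C _
    have hNd : N.degree = (m + 1 : ℕ) := by rw [hN, degree_prod_X_sub_C, hJ]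
    have hpd : p.natDegree ≤ m := by
      have := mem_degreeLT.1 hp
      rw [add_zero] at this
      exact natDegree_le_iff_degree_le.2 (Order.le_of_lt_succ (by exact_mod_cast this))
    have hq : ((X * p) /ₘ N).natDegree = 0 := by
      rw [natDegree_divByMonic _ hNm, natDegree_eq_of_degree_eq_some hNd]
      have := natDegree_mul_le (p := (X : K[X])) (q := p)
      rw [natDegree_X] at this
      omega
    have hdiv := modByMonic_add_div (X * p) N
    rw [eq_C_of_natDegree_eq_zero hq] at hdiv
    have h5 : y m * (f * aeval (y m) p) = f * aeval (y m) ((X * p) %ₘ N) +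
        ((X * p) /ₘ N).coeff 0 • (f * aeval (y m) N) := by
      rw [Algebra.smul_def]
      have := congrArg (aeval (y m)) hdiv
      simp only [map_mul, map_add, aeval_X, aeval_C] at this
      linear_combination - f * this
    rw [h5]
    refine Submodule.add_mem _ ?_ (Submodule.smul_mem _ _ (h1 f hf))
    rw [monoSpan_succ]
    refine Submodule.mul_mem_mul hf (aeval_mem_polySpan _ ?_)
    exact (degree_modByMonic_lt _ hNm).trans_eq hNd
  exact h4 hu

/-- A bound, uniform in the field, for the number of values of the last coordinate on the
solutions of a system of equations `∏ i ≤ m, (x i - a i j) = b j`. -/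
theorem card_image_le_factorial_of_prod_sub_eq (Z : Finset (ℕ → K)) (a : ℕ → ι → K) (m : ℕ)
    (J : Finset ι) (hJ : J.card = m + 1) (ha : ∀ i < m, Set.InjOn (a i) J) (b : ι → K)
    (hZ : ∀ x ∈ Z, ∀ j ∈ J, ∏ i ∈ Finset.range (m + 1), (x i - a i j) = b j)
    (hinj : Set.InjOn (fun x : ℕ → K => x m) Z) : Z.card ≤ (m + 1).factorial := by
  classical
  let y : ℕ → (Z → K) := fun i x => x.1 i
  have hb : ∀ j ∈ J, diffProd y a (m + 1) j = algebraMap K (Z → K) (b j) := by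
    intro j hj
    ext x
    simpa [diffProd, Finset.prod_apply, y] using hZ x.1 x.2 j hj
  obtain ⟨S, hS, hS'⟩ := exists_monoSpan_eq_span (K := K) y (m + 1)
  have hpow : ∀ k : ℕ, y m ^ k ∈ monoSpan K y 0 (m + 1) := by
    intro k
    induction k with
    | zero => simpa using one_mem_monoSpan (K := K) y 0 (m + 1)
    | succ k ih =>
      rw [pow_succ']
      exact mul_mem_monoSpan y a m J hJ ha b hb ih
  have hlin : LinearIndependent K (fun k : Fin Z.card => (y m ^ (k : ℕ) : Z → K)) := by
    rw [Fintype.linearIndependent_iff]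
    intro g hg k
    let p : K[X] := ∑ k : Fin Z.card, C (g k) * X ^ (k : ℕ)
    have hp : p = 0 := by
      refine eq_zero_of_degree_lt_of_eval_finset_eq_zero (Z.image fun x => x m) ?_ ?_
      · rw [Finset.card_image_of_injOn hinj]
        exact degree_sum_fin_lt g
      · intro z hz
        obtain ⟨x, hx, rfl⟩ := Finset.mem_image.1 hz
        have := congrFun hg ⟨x, hx⟩
        simpa [p, eval_finsetSum, y, Finset.sum_apply] using this
    have := congrArg (fun p : K[X] => p.coeff k) hp
    simpa [p, finsetSum_coeff, coeff_C_mul, coeff_X_pow, Fin.val_inj, Finset.sum_ite_eq] using this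
  have hle : Submodule.span K (Set.range fun k : Fin Z.card => (y m ^ (k : ℕ) : Z → K)) ≤
      Submodule.span K (S : Set (Z → K)) := by
    rw [← hS', Submodule.span_le]
    rintro _ ⟨k, rfl⟩
    exact hpow k
  have h1 := finrank_span_eq_card hlin
  have h2 := Submodule.finrank_mono hle
  have h3 := finrank_span_finset_le_card (R := K) S
  rw [h1, Fintype.card_fin] at h2
  exact h2.trans (h3.trans hS)

end Elimination

section NormGraph

/-- The product of the first `s` iterated Frobenius images of `u`; on `GaloisField p s` this is
the norm to the prime field. -/
def frobProd {F : Type*} [CommRing F] (p s : ℕ) (u : F) : F :=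
  ∏ i ∈ Finset.range s, u ^ p ^ i

variable {F : Type*} [Field F] {p : ℕ}

lemma frobProd_sub_comm (s : ℕ) (x y : F) :
    frobProd p s (y - x) = frobProd p s (-1) * frobProd p s (x - y) := by
  rw [frobProd, frobProd, frobProd, ← Finset.prod_mul_distrib]
  refine Finset.prod_congr rfl fun i _ => ?_
  rw [← mul_pow]
  ring

lemma exists_le_card_frobProd_eq [Fact p.Prime] [Fintype F] [DecidableEq F] {s : ℕ} (hs : 1 ≤ s)
    (hF : Fintype.card F = p ^ s) :
    ∃ c : F, p ^ (s - 1) ≤ (Finset.univ.filter fun u : F => frobProd p s u = c).card := by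
  open Polynomial in
  have hp : p.Prime := Fact.out
  have hfix : ∀ u : F, frobProd p s u ^ p = frobProd p s u := by
    intro u
    obtain ⟨m, rfl⟩ : ∃ m, s = m + 1 := ⟨s - 1, by omega⟩
    rw [frobProd, ← Finset.prod_pow]
    simp only [← pow_mul, ← pow_succ]
    rw [Finset.prod_range_succ, Finset.prod_range_succ', pow_zero, pow_one, ← hF,
      FiniteField.pow_card]
  let T : Finset F := (X ^ p - X : F[X]).roots.toFinset
  have hT : T.card ≤ p := by
    refine (Multiset.toFinset_card_le _).trans ((card_roots' _).trans ?_)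
    rw [FiniteField.X_pow_card_sub_X_natDegree_eq F hp.one_lt]
  have hmaps : ∀ u ∈ (Finset.univ : Finset F), frobProd p s u ∈ T := by
    intro u _
    rw [Multiset.mem_toFinset, mem_roots (FiniteField.X_pow_card_sub_X_ne_zero F hp.one_lt)]
    simp [IsRoot, hfix]
  have hTne : T.Nonempty := ⟨_, hmaps 0 (Finset.mem_univ _)⟩
  obtain ⟨c, -, hc⟩ := Finset.exists_le_card_fiber_of_mul_le_card_of_maps_to
    (n := p ^ (s - 1)) hmaps hTne (by
      rw [Finset.card_univ, hF]
      calc T.card * p ^ (s - 1) ≤ p * p ^ (s - 1) := Nat.mul_le_mul_right _ hT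
        _ = p ^ s := by rw [← pow_succ']; congr 1; omega)
  exact ⟨c, hc⟩

variable [Fact p.Prime] [CharP F p]

lemma pow_char_pow_injective (i : ℕ) : Function.Injective fun u : F => u ^ p ^ i := by
  have : ExpChar F p := ExpChar.prime Fact.out
  exact iterateFrobenius_inj F p i

lemma card_le_of_frobProd_sub_eq {s : ℕ} (hs : 1 ≤ s) (c : F) (X Y : Finset F)
    (hY : Y.card = s) (h : ∀ x ∈ X, ∀ y ∈ Y, frobProd p s (x - y) = c) :
    X.card ≤ s.factorial := by
  classical
  obtain ⟨m, rfl⟩ : ∃ m, s = m + 1 := ⟨s - 1, by omega⟩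
  let e : F → ℕ → F := fun x i => x ^ p ^ i
  have he : Function.Injective e := fun x y hxy =>
    pow_char_pow_injective (p := p) 0 (congrFun hxy 0)
  rw [← Finset.card_image_of_injective X he]
  refine card_image_le_factorial_of_prod_sub_eq _ (fun i y => y ^ p ^ i) m Y hY
    (fun i _ => (pow_char_pow_injective i).injOn) (fun _ => c) ?_ ?_
  · intro _ hx y hy
    obtain ⟨x, hxX, rfl⟩ := Finset.mem_image.1 hx
    rw [← h x hxX y hy, frobProd]
    exact Finset.prod_congr rfl fun i _ => (sub_pow_char_pow x y i).symm
  · intro _ hx _ hy hxy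
    obtain ⟨x, -, rfl⟩ := Finset.mem_image.1 hx
    obtain ⟨y, -, rfl⟩ := Finset.mem_image.1 hy
    rw [pow_char_pow_injective (p := p) m hxy]

lemma card_le_of_frobProd_sub_eq' {s : ℕ} (hs : 1 ≤ s) (c : F) (X Y : Finset F)
    (hX : X.card = s) (h : ∀ x ∈ X, ∀ y ∈ Y, frobProd p s (x - y) = c) :
    Y.card ≤ s.factorial :=
  card_le_of_frobProd_sub_eq (p := p) hs (frobProd p s (-1) * c) Y X hX fun y hy x hx => by
    rw [frobProd_sub_comm, h x hx y hy]

/-- Norm graphs: dense bipartite relations without large `K_{s,t}`. -/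
lemma exists_dense_relation {s : ℕ} (hs : 1 ≤ s) (p : ℕ) (hp : p.Prime) :
    ∃ (F : Type) (_ : Fintype F) (R : Finset (F × F)), Fintype.card F = p ^ s ∧
      p ^ (2 * s - 1) ≤ R.card ∧
      (∀ X Y : Finset F, Y.card = s → (∀ x ∈ X, ∀ y ∈ Y, (x, y) ∈ R) → X.card ≤ s.factorial) ∧
      (∀ X Y : Finset F, X.card = s → (∀ x ∈ X, ∀ y ∈ Y, (x, y) ∈ R) → Y.card ≤ s.factorial) := by
  classical
  have : Fact p.Prime := ⟨hp⟩
  let F := GaloisField p s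
  let : Fintype F := Fintype.ofFinite F
  have hF : Fintype.card F = p ^ s := by
    rw [← Nat.card_eq_fintype_card]; exact GaloisField.card p s (by omega)
  obtain ⟨c, hc⟩ := exists_le_card_frobProd_eq hs hF
  let U := Finset.univ.filter fun u : F => frobProd p s u = c
  refine ⟨F, inferInstance, Finset.univ.filter fun q : F × F => frobProd p s (q.1 - q.2) = c,
    hF, ?_, ?_, ?_⟩
  · have h1 : ((Finset.univ : Finset F) ×ˢ U).card ≤
        (Finset.univ.filter fun q : F × F => frobProd p s (q.1 - q.2) = c).card := by
      refine Finset.card_le_card_of_injOn (fun q => (q.1 + q.2, q.1)) ?_ ?_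
      · intro q hq
        simpa [U] using hq
      · rintro ⟨a, b⟩ - ⟨a', b'⟩ - h
        simp only [Prod.mk.injEq] at h
        obtain ⟨h, rfl⟩ := h
        rw [add_left_cancel h]
    refine le_trans ?_ h1
    rw [Finset.card_product, Finset.card_univ, hF]
    calc p ^ (2 * s - 1) = p ^ s * p ^ (s - 1) := by rw [← pow_add]; congr 1; omega
      _ ≤ _ := Nat.mul_le_mul_left _ hc
  · intro X Y hY h
    exact card_le_of_frobProd_sub_eq (p := p) hs c X Y hY fun x hx y hy => by
      simpa using h x hx y hy
  · intro X Y hX h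
    exact card_le_of_frobProd_sub_eq' (p := p) hs c X Y hX fun x hx y hy => by
      simpa using h x hx y hy

end NormGraph

section KovariSosTuran

open Finset

/-- Kővári–Sós–Turán bound for the number of pairs of a relation on `U` containing no
complete bipartite `T × S` with `#S = s`, `#T = t`. -/
lemma sum_card_filter_le_rpow {α : Type*} (U : Finset α) (R : α → α → Prop)
    [∀ v, DecidablePred (R v)] {s t : ℕ} (hs : 1 ≤ s)
    (hfree : ∀ S ⊆ U, ∀ T ⊆ U, #S = s → #T = t → ∃ v ∈ T, ∃ a ∈ S, ¬ R v a) :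
    ∑ v ∈ U, (#{a ∈ U | R v a} : ℝ) ≤ (s + t) * (#U : ℝ) ^ (2 - 1 / (s : ℝ)) := by
  classical
  set n := #U with hn
  have hsR : (1 : ℝ) ≤ s := by exact_mod_cast hs
  rcases Nat.eq_zero_or_pos n with h0 | hpos
  · have : U = ∅ := card_eq_zero.1 h0
    rw [this, sum_empty]
    positivity
  have hnR : (1 : ℝ) ≤ n := by exact_mod_cast hpos
  let d : α → ℕ := fun v => #{a ∈ U | R v a}
  have hcount : ∑ v ∈ U, (d v).choose s ≤ t * n.choose s := by
    have h1 : ∀ v ∈ U, (d v).choose s =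
        #{S ∈ U.powersetCard s | ∀ a ∈ S, R v a} := by
      intro v _
      rw [← card_powersetCard]
      congr 1
      ext S
      simp only [mem_powersetCard, mem_filter, subset_iff]
      grind
    have h2 := sum_card_bipartiteAbove_eq_sum_card_bipartiteBelow
      (s := U) (t := U.powersetCard s) (fun v S => ∀ a ∈ S, R v a)
    simp only [bipartiteAbove, bipartiteBelow] at h2
    rw [sum_congr rfl h1, h2]
    refine (sum_le_card_nsmul _ _ t ?_).trans_eq (by rw [card_powersetCard, smul_eq_mul, mul_comm])
    intro S hS
    by_contra! hlt
    obtain ⟨T, hT, hTc⟩ := exists_subset_card_eq hlt.le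
    obtain ⟨hSU, hSc⟩ := mem_powersetCard.1 hS
    obtain ⟨v, hv, a, ha, hva⟩ := hfree S hSU T (hT.trans (filter_subset _ _)) hSc hTc
    exact hva ((mem_filter.1 (hT hv)).2 a ha)
  have hpow : ∑ v ∈ U, (d v + 1 - s) ^ s ≤ t * n ^ s := by
    calc ∑ v ∈ U, (d v + 1 - s) ^ s ≤ ∑ v ∈ U, s.factorial * (d v).choose s :=
          sum_le_sum fun v _ => by
            rw [← Nat.descFactorial_eq_factorial_mul_choose]
            exact Nat.pow_sub_le_descFactorial _ _
      _ = s.factorial * ∑ v ∈ U, (d v).choose s := by rw [mul_sum]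
      _ ≤ s.factorial * (t * n.choose s) := Nat.mul_le_mul_left _ hcount
      _ = t * n.descFactorial s := by
          rw [Nat.descFactorial_eq_factorial_mul_choose]; ring
      _ ≤ t * n ^ s := Nat.mul_le_mul_left _ (Nat.descFactorial_le_pow _ _)
  set B : ℝ := ∑ v ∈ U, ((d v + 1 - s : ℕ) : ℝ) with hB
  have hB0 : 0 ≤ B := sum_nonneg fun _ _ => Nat.cast_nonneg _
  have hBs : B ^ s ≤ (t * (n : ℝ) ^ (2 - 1 / (s : ℝ))) ^ s := by
    obtain ⟨m, rfl⟩ : ∃ m, s = m + 1 := ⟨s - 1, by omega⟩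
    have h1 : B ^ (m + 1) ≤ (n : ℝ) ^ m * (t * n ^ (m + 1)) := by
      refine (pow_sum_le_card_mul_sum_pow (fun _ _ => Nat.cast_nonneg _) m).trans ?_
      exact mul_le_mul_of_nonneg_left (by exact_mod_cast hpow) (by positivity)
    refine h1.trans ?_
    have h2 : ((n : ℝ) ^ (2 - 1 / ((m + 1 : ℕ) : ℝ))) ^ (m + 1) = (n : ℝ) ^ (2 * m + 1) := by
      rw [← Real.rpow_natCast, ← Real.rpow_mul (by positivity), ← Real.rpow_natCast]
      congr 1
      have : ((m + 1 : ℕ) : ℝ) ≠ 0 := by positivity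
      field_simp
      push_cast
      ring
    rw [mul_pow, h2]
    have h3 : (t : ℝ) ≤ (t : ℝ) ^ (m + 1) := by exact_mod_cast Nat.le_self_pow (by omega) t
    calc (n : ℝ) ^ m * (t * n ^ (m + 1)) = t * n ^ (2 * m + 1) := by ring
      _ ≤ _ := by gcongr
  have hBle : B ≤ t * (n : ℝ) ^ (2 - 1 / (s : ℝ)) :=
    le_of_pow_le_pow_left₀ (by omega) (by positivity) hBs
  have hnle : (n : ℝ) ≤ (n : ℝ) ^ (2 - 1 / (s : ℝ)) := by
    refine Real.self_le_rpow_of_one_le hnR ?_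
    have : 1 / (s : ℝ) ≤ 1 := by rw [div_le_one (by positivity)]; exact hsR
    linarith
  have hd : ∑ v ∈ U, (d v : ℝ) ≤ s * n + B := by
    have : ∑ v ∈ U, (d v : ℝ) ≤ ∑ v ∈ U, ((s : ℝ) + ((d v + 1 - s : ℕ) : ℝ)) :=
      sum_le_sum fun v _ => by exact_mod_cast (by omega : d v ≤ s + (d v + 1 - s))
    rw [sum_add_distrib, sum_const, nsmul_eq_mul] at this
    linarith
  calc ∑ v ∈ U, (d v : ℝ) ≤ s * n + B := hd
    _ ≤ s * (n : ℝ) ^ (2 - 1 / (s : ℝ)) + t * (n : ℝ) ^ (2 - 1 / (s : ℝ)) := by gcongr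
    _ = _ := by ring

end KovariSosTuran

section UpperBound

open Finset

variable {α : Type*} {c : EdgeColouring α}

/-- `v` dominates `w` if `s(v, w)` is the only edge of its colour at `w`. -/
def Dominates (c : EdgeColouring α) (v w : α) : Prop :=
  v ≠ w ∧ ∀ u, u ≠ w → c s(u, w) = c s(v, w) → u = v

lemma IsStarColouring.dominates_or (hc : IsStarColouring c) {v w : α} (hvw : v ≠ w) :
    Dominates c v w ∨ Dominates c w v := by
  by_contra! h
  obtain ⟨h1, h2⟩ := h
  simp only [Dominates, not_and, not_forall] at h1 h2
  obtain ⟨u, huw, hu, huv⟩ := h1 hvw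
  obtain ⟨x, hxv, hx, hxw⟩ := h2 hvw.symm
  rw [Sym2.eq_swap (a := w)] at hx
  have hux : u = x := by
    rcases hc.1 u w x v huw hxv (hu.trans hx.symm) with h | h | h | h
    · exact h
    · exact absurd h huv
    · exact absurd h.symm hxw
    · exact absurd h.symm hvw
  subst hux
  refine hc.2 u w v huw hvw.symm huv ⟨?_, ?_⟩
  · rw [hu, Sym2.eq_swap]
  · rw [hx, Sym2.eq_swap]

open Classical in
lemma IsStarColouring.two_mul_card_filter_le (hc : IsStarColouring c) (U : Finset α) :
    2 * #{v ∈ U | 4 * #{w ∈ U | Dominates c v w} + 1 < #U} ≤ #U := by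
  set L := {v ∈ U | 4 * #{w ∈ U | Dominates c v w} + 1 < #U}
  have hLU : L ⊆ U := filter_subset _ _
  rcases L.eq_empty_or_nonempty with h0 | hne
  · simp [h0]
  have h1 : ∀ v ∈ L, #L ≤ #{w ∈ L | Dominates c v w} + #{w ∈ L | Dominates c w v} + 1 := by
    intro v hv
    have : L.erase v ⊆ {w ∈ L | Dominates c v w} ∪ {w ∈ L | Dominates c w v} := by
      intro w hw
      obtain ⟨hwv, hw⟩ := mem_erase.1 hw
      rcases hc.dominates_or hwv.symm with h | h <;> simp [hw, h]
    have := (card_le_card this).trans (card_union_le _ _)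
    rw [card_erase_of_mem hv] at this
    omega
  have h2 : ∀ v ∈ L, 4 * #{w ∈ L | Dominates c v w} + 2 ≤ #U := by
    intro v hv
    have h3 := (mem_filter.1 hv).2
    have h4 : #{w ∈ L | Dominates c v w} ≤ #{w ∈ U | Dominates c v w} :=
      card_le_card (filter_subset_filter _ hLU)
    omega
  have h3 : ∑ v ∈ L, #{w ∈ L | Dominates c v w} = ∑ v ∈ L, #{w ∈ L | Dominates c w v} :=
    sum_card_bipartiteAbove_eq_sum_card_bipartiteBelow (s := L) (t := L) (Dominates c)
  have h4 := sum_le_sum h1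
  have h5 := sum_le_sum h2
  simp only [sum_add_distrib, sum_const, smul_eq_mul, ← mul_sum] at h4 h5
  rw [← h3] at h4
  have hpos : 0 < #L := card_pos.2 hne
  by_contra! hlt
  nlinarith

variable {E : α → α → Prop}

open Classical in
lemma sum_card_filter_le_of_symm (hsymm : ∀ u v, E u v → E v u) {L U : Finset α} (hLU : L ⊆ U) :
    ∑ v ∈ U, #{a ∈ U | E v a} ≤
      ∑ v ∈ L, #{a ∈ L | E v a} + 2 * ∑ v ∈ U \ L, #{a ∈ U | E v a} := by
  have h1 : ∀ v, #{a ∈ U | E v a} = #{a ∈ L | E v a} + #{a ∈ U \ L | E v a} := by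
    intro v
    rw [← card_union_of_disjoint (disjoint_filter_filter disjoint_sdiff), ← filter_union,
      union_sdiff_of_subset hLU]
  have h2 : ∑ v ∈ L, #{a ∈ U \ L | E v a} ≤ ∑ v ∈ U \ L, #{a ∈ U | E v a} := by
    have := sum_card_bipartiteAbove_eq_sum_card_bipartiteBelow (s := L) (t := U \ L) E
    simp only [bipartiteAbove, bipartiteBelow] at this
    rw [this]
    refine sum_le_sum fun v _ => card_le_card fun a ha => ?_
    obtain ⟨haL, ha⟩ := mem_filter.1 ha
    exact mem_filter.2 ⟨hLU haL, hsymm _ _ ha⟩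
  have h3 : ∑ v ∈ L, #{a ∈ U | E v a} =
      ∑ v ∈ L, #{a ∈ L | E v a} + ∑ v ∈ L, #{a ∈ U \ L | E v a} := by
    rw [← sum_add_distrib]
    exact sum_congr rfl fun v _ => h1 v
  rw [← sum_sdiff hLU, h3]
  omega

open Classical in
lemma IsStarColouring.mul_sum_card_filter_le (hc : IsStarColouring c)
    (hsymm : ∀ u v, E u v → E v u)
    (hinj : ∀ u v x y, E u v → E x y → c s(u, v) = c s(x, y) → s(u, v) = s(x, y))
    (U : Finset α) : ∃ L ⊆ U, 2 * #L ≤ #U ∧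
      (#U - 1) * ∑ v ∈ U, #{a ∈ U | E v a} ≤ (#U - 1) * ∑ v ∈ L, #{a ∈ L | E v a} +
        8 * ∑ w ∈ U, (∑ v ∈ U, #{a ∈ U | Dominates c v w ∧ E v a ∧ a ≠ w ∧
          c s(v, a) ≠ c s(v, w)} + 2 * #U) := by
  set L := {v ∈ U | 4 * #{w ∈ U | Dominates c v w} + 1 < #U}
  refine ⟨L, filter_subset _ _, hc.two_mul_card_filter_le U, ?_⟩
  have h1 := sum_card_filter_le_of_symm hsymm (L := L) (U := U) (filter_subset _ _)
  have h2 : (#U - 1) * ∑ v ∈ U \ L, #{a ∈ U | E v a} ≤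
      4 * ∑ v ∈ U, #{w ∈ U | Dominates c v w} * #{a ∈ U | E v a} := by
    rw [mul_sum, mul_sum]
    refine (sum_le_sum fun v hv => ?_).trans (sum_le_sum_of_subset sdiff_subset)
    rw [← mul_assoc]
    refine Nat.mul_le_mul_right _ ?_
    obtain ⟨hvU, hvL⟩ := mem_sdiff.1 hv
    have : ¬ (4 * #{w ∈ U | Dominates c v w} + 1 < #U) := fun h => hvL (mem_filter.2 ⟨hvU, h⟩)
    omega
  have h3 : ∀ v w, Dominates c v w → #{a ∈ U | E v a} ≤
      #{a ∈ U | Dominates c v w ∧ E v a ∧ a ≠ w ∧ c s(v, a) ≠ c s(v, w)} + 2 := by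
    intro v w hvw
    have hsub : {a ∈ U | E v a} ⊆
        {a ∈ U | Dominates c v w ∧ E v a ∧ a ≠ w ∧ c s(v, a) ≠ c s(v, w)} ∪
          ({w} ∪ {a ∈ U | E v a ∧ c s(v, a) = c s(v, w)}) := by
      intro a ha
      simp only [mem_union, mem_filter, mem_singleton] at ha ⊢
      tauto
    have hone : #{a ∈ U | E v a ∧ c s(v, a) = c s(v, w)} ≤ 1 := by
      refine card_le_one.2 fun a ha b hb => ?_
      simp only [mem_filter] at ha hb
      have := hinj v a v b ha.2.1 hb.2.1 (ha.2.2.trans hb.2.2.symm)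
      exact Sym2.congr_right.1 this
    refine (card_le_card hsub).trans ((card_union_le _ _).trans ?_)
    have := card_union_le {w} {a ∈ U | E v a ∧ c s(v, a) = c s(v, w)}
    rw [card_singleton] at this
    omega
  have h4 : ∑ v ∈ U, #{w ∈ U | Dominates c v w} * #{a ∈ U | E v a} ≤
      ∑ w ∈ U, (∑ v ∈ U, #{a ∈ U | Dominates c v w ∧ E v a ∧ a ≠ w ∧
          c s(v, a) ≠ c s(v, w)} + 2 * #U) := by
    have h5 : ∀ v ∈ U, #{w ∈ U | Dominates c v w} * #{a ∈ U | E v a} =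
        ∑ w ∈ U, if Dominates c v w then #{a ∈ U | E v a} else 0 := by
      intro v _
      rw [← sum_filter, sum_const, smul_eq_mul]
    rw [sum_congr rfl h5, sum_comm]
    refine sum_le_sum fun w _ => ?_
    calc ∑ v ∈ U, (if Dominates c v w then #{a ∈ U | E v a} else 0)
        ≤ ∑ v ∈ U, (#{a ∈ U | Dominates c v w ∧ E v a ∧ a ≠ w ∧ c s(v, a) ≠ c s(v, w)} + 2) := by
          refine sum_le_sum fun v _ => ?_
          split_ifs with h
          · exact h3 v w h
          · exact Nat.zero_le _
      _ = _ := by rw [sum_add_distrib, sum_const, smul_eq_mul, mul_comm 2]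
  have h6 := Nat.mul_le_mul_left (#U - 1) h1
  rw [mul_add, mul_left_comm] at h6
  omega

open Classical in
lemma IsStarColouring.sum_card_filter_le (hc : IsStarColouring c)
    (hsymm : ∀ u v, E u v → E v u) (hirr : ∀ v, ¬ E v v)
    (hinj : ∀ u v x y, E u v → E x y → c s(u, v) = c s(x, y) → s(u, v) = s(x, y))
    {s t : ℕ} (hs : 1 ≤ s)
    (hfree : ∀ w, ∀ S T : Finset α, #S = s → #T = t →
      ∃ v ∈ T, ∃ a ∈ S, ¬ (Dominates c v w ∧ E v a ∧ a ≠ w ∧ c s(v, a) ≠ c s(v, w)))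
    (U : Finset α) :
    (∑ v ∈ U, #{a ∈ U | E v a} : ℝ) ≤ 32 * (s + t + 2) * (#U : ℝ) ^ (2 - 1 / (s : ℝ)) := by
  induction h : #U using Nat.strong_induction_on generalizing U with
  | _ n ih =>
  subst h
  set β : ℝ := 2 - 1 / (s : ℝ) with hβ
  have hβ1 : 1 ≤ β := by
    have hsR : (1 : ℝ) ≤ s := by exact_mod_cast hs
    have : 1 / (s : ℝ) ≤ 1 := by rw [div_le_one (by positivity)]; exact hsR
    linarith
  rcases Nat.lt_or_ge (#U) 2 with hlt | hge
  · have : ∀ v ∈ U, #{a ∈ U | E v a} = 0 := by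
      intro v hv
      refine card_eq_zero.2 (filter_eq_empty_iff.2 fun a ha hva => ?_)
      rw [card_le_one.1 (by omega) v hv a ha] at hva
      exact hirr a hva
    rw [sum_congr rfl fun v hv => by rw [this v hv, Nat.cast_zero], sum_const_zero]
    positivity
  obtain ⟨L, hLU, hL, hle⟩ := hc.mul_sum_card_filter_le hsymm hinj U
  have hn2 : (2 : ℝ) ≤ #U := by exact_mod_cast hge
  have hle' := Nat.cast_le (α := ℝ).2 hle
  push_cast [Nat.cast_sub (by omega : 1 ≤ #U)] at hle'
  have hkst : ∀ w, ∑ v ∈ U, (#{a ∈ U | Dominates c v w ∧ E v a ∧ a ≠ w ∧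
      c s(v, a) ≠ c s(v, w)} : ℝ) ≤ (s + t) * (#U : ℝ) ^ β := fun w =>
    sum_card_filter_le_rpow U (fun v a => Dominates c v w ∧ E v a ∧ a ≠ w ∧
      c s(v, a) ≠ c s(v, w)) hs fun S _ T _ => hfree w S T
  have hself : (#U : ℝ) ≤ (#U : ℝ) ^ β := Real.self_le_rpow_of_one_le (by linarith) hβ1
  have hsum : ∑ w ∈ U, (∑ v ∈ U, (#{a ∈ U | Dominates c v w ∧ E v a ∧ a ≠ w ∧
      c s(v, a) ≠ c s(v, w)} : ℝ) + 2 * #U) ≤ #U * ((s + t + 2) * (#U : ℝ) ^ β) := by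
    rw [← nsmul_eq_mul]
    refine sum_le_card_nsmul _ _ _ fun w _ => ?_
    linarith [hkst w]
  have hLb : (∑ v ∈ L, #{a ∈ L | E v a} : ℝ) ≤ 16 * (s + t + 2) * (#U : ℝ) ^ β := by
    refine (ih _ (by omega) L rfl).trans ?_
    have h1 : (#L : ℝ) ≤ 1 / 2 * #U := by
      have : (2 * #L : ℝ) ≤ #U := by exact_mod_cast hL
      linarith
    have h2 : (#L : ℝ) ^ β ≤ 1 / 2 * (#U : ℝ) ^ β := by
      calc (#L : ℝ) ^ β ≤ (1 / 2 * #U) ^ β := Real.rpow_le_rpow (by positivity) h1 (by linarith)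
        _ = (1 / 2) ^ β * (#U : ℝ) ^ β := Real.mul_rpow (by norm_num) (by positivity)
        _ ≤ 1 / 2 * (#U : ℝ) ^ β := by
          gcongr
          simpa using Real.rpow_le_rpow_of_exponent_ge (x := 1 / 2) (by norm_num) (by norm_num) hβ1
    calc 32 * (s + t + 2) * (#L : ℝ) ^ β ≤ 32 * (s + t + 2) * (1 / 2 * (#U : ℝ) ^ β) := by gcongr
      _ = _ := by ring
  set P : ℝ := (s + t + 2) * (#U : ℝ) ^ β with hP
  have hP0 : 0 ≤ P := by positivity
  have hN : 0 < (#U : ℝ) - 1 := by linarith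
  refine le_of_mul_le_mul_left ?_ hN
  calc ((#U : ℝ) - 1) * ∑ v ∈ U, (#{a ∈ U | E v a} : ℝ)
      ≤ ((#U : ℝ) - 1) * ∑ v ∈ L, (#{a ∈ L | E v a} : ℝ) + 8 * (#U * P) := by linarith
    _ ≤ ((#U : ℝ) - 1) * (16 * P) + 8 * (2 * ((#U : ℝ) - 1) * P) := by
        have h1 : (#U : ℝ) * P ≤ 2 * ((#U : ℝ) - 1) * P :=
          mul_le_mul_of_nonneg_right (by linarith) hP0
        have h2 : ((#U : ℝ) - 1) * ∑ v ∈ L, (#{a ∈ L | E v a} : ℝ) ≤ ((#U : ℝ) - 1) * (16 * P) :=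
          mul_le_mul_of_nonneg_left (by rw [hP]; linarith) hN.le
        linarith
    _ = ((#U : ℝ) - 1) * (32 * (s + t + 2) * (#U : ℝ) ^ β) := by rw [hP]; ring

lemma hasRainbowCopy_completeBipartiteGraph_iff {k t : ℕ} :
    HasRainbowCopy c (completeBipartiteGraph (Fin k) (Fin t)) ↔
      ∃ A T : Finset α, #A = k ∧ #T = t ∧ Disjoint A T ∧
        ∀ a ∈ A, ∀ v ∈ T, ∀ a' ∈ A, ∀ v' ∈ T, c s(a, v) = c s(a', v') → a = a' ∧ v = v' := by
  constructor
  · rintro ⟨f, hf⟩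
    refine ⟨univ.map (Function.Embedding.inl.trans f), univ.map (Function.Embedding.inr.trans f),
      by simp, by simp, ?_, ?_⟩
    · rw [Finset.disjoint_left]
      simp
    · simp only [mem_map, mem_univ, true_and, forall_exists_index, forall_apply_eq_imp_iff,
        Function.Embedding.trans_apply, Function.Embedding.inl_apply, Function.Embedding.inr_apply]
      intro a v a' v' h
      have := mt (hf (.inl a) (.inr v) (.inl a') (.inr v') (by simp) (by simp)) (not_not.2 h)
      simpa using this
  · rintro ⟨A, T, hA, hT, hd, h⟩
    let fA := (A.equivFinOfCardEq hA).symm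
    let fT := (T.equivFinOfCardEq hT).symm
    refine ⟨⟨Sum.elim (fun i => fA i) (fun i => fT i), ?_⟩, ?_⟩
    · refine Function.Injective.sumElim (Subtype.val_injective.comp fA.injective)
        (Subtype.val_injective.comp fT.injective) fun i j hij => ?_
      exact Finset.disjoint_left.1 hd (fA i).2 (hij ▸ (fT j).2)
    · have key : ∀ i j i' j', s((Sum.inl i : Fin k ⊕ Fin t), Sum.inr j) ≠ s(.inl i', .inr j') →
          c s((fA i : α), fT j) ≠ c s((fA i' : α), fT j') := by
        intro i j i' j' hne heq
        obtain ⟨h1, h2⟩ := h _ (fA i).2 _ (fT j).2 _ (fA i').2 _ (fT j').2 heq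
        rw [fA.injective (Subtype.ext h1), fT.injective (Subtype.ext h2)] at hne
        exact hne rfl
      rintro (u | u) (v | v) (x | x) (y | y) huv hxy hne
      all_goals simp only [completeBipartiteGraph_adj, Sum.isLeft_inl, Sum.isLeft_inr,
        Sum.isRight_inl, Sum.isRight_inr, Bool.false_eq_true, and_false, false_and,
        or_self] at huv hxy
      · exact key u v x y hne
      · rw [Sym2.eq_swap (a := Sum.inr x)] at hne
        simpa [Sym2.eq_swap (a := ((fT x : α)))] using key u v y x hne
      · rw [Sym2.eq_swap (a := Sum.inr u)] at hne
        simpa [Sym2.eq_swap (a := ((fT u : α)))] using key v u x y hne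
      · rw [Sym2.eq_swap (a := Sum.inr u), Sym2.eq_swap (a := Sum.inr x)] at hne
        simpa [Sym2.eq_swap (a := ((fT u : α))), Sym2.eq_swap (a := ((fT x : α)))]
          using key v u y x hne

lemma HasRainbowCopy.comap_equiv_iff {β γ : Type*} {G : SimpleGraph β} (e : γ ≃ β) :
    HasRainbowCopy c (G.comap e) ↔ HasRainbowCopy c G := by
  constructor
  · rintro ⟨f, hf⟩
    refine ⟨e.symm.toEmbedding.trans f, fun u v x y huv hxy hne => ?_⟩
    refine hf (e.symm u) (e.symm v) (e.symm x) (e.symm y) (by simpa) (by simpa) fun h => hne ?_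
    simpa using congrArg (Sym2.map e) h
  · rintro ⟨f, hf⟩
    refine ⟨e.toEmbedding.trans f, fun u v x y huv hxy hne => ?_⟩
    refine hf (e u) (e v) (e x) (e y) huv hxy fun h => hne ?_
    simpa using congrArg (Sym2.map e.symm) h

/-- A star-colouring without a rainbow `K_{s+1,t}` has `O(n ^ (2 - 1/s))` colours. -/
theorem IsStarColouring.colourCount_le [Fintype α] (hc : IsStarColouring c) {s t : ℕ}
    (hs : 1 ≤ s) (ht : 1 ≤ t)
    (hno : ¬ HasRainbowCopy c (completeBipartiteGraph (Fin (s + 1)) (Fin t))) :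
    (colourCount c : ℝ) ≤ 32 * (s + t + 2) * (Fintype.card α : ℝ) ^ (2 - 1 / (s : ℝ)) := by
  classical
  rcases isEmpty_or_nonempty α with hα | hα
  · have : colourCount c = 0 := by simp [colourCount, Set.eq_empty_of_isEmpty]
    rw [this, Nat.cast_zero]
    positivity
  have hrep : ∀ k : ℕ, ∃ e : Sym2 α, k ∈ c '' {e : Sym2 α | ¬ e.IsDiag} → ¬ e.IsDiag ∧ c e = k := by
    intro k
    by_cases hk : k ∈ c '' {e : Sym2 α | ¬ e.IsDiag}
    · obtain ⟨e, he⟩ := hk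
      exact ⟨e, fun _ => he⟩
    · exact ⟨s(Classical.arbitrary α, Classical.arbitrary α), fun h => absurd h hk⟩
  choose rep hrep using hrep
  let E : α → α → Prop := fun u v => u ≠ v ∧ rep (c s(u, v)) = s(u, v)
  have hsymm : ∀ u v, E u v → E v u := fun u v h => by
    refine ⟨h.1.symm, ?_⟩
    rw [Sym2.eq_swap]
    exact h.2
  have hinj : ∀ u v x y, E u v → E x y → c s(u, v) = c s(x, y) → s(u, v) = s(x, y) :=
    fun u v x y h h' heq => by rw [← h.2, ← h'.2, heq]
  have hfree : ∀ w, ∀ S T : Finset α, #S = s → #T = t →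
      ∃ v ∈ T, ∃ a ∈ S, ¬ (Dominates c v w ∧ E v a ∧ a ≠ w ∧ c s(v, a) ≠ c s(v, w)) := by
    intro w S T hS hT
    by_contra! hall
    obtain ⟨a₀, ha₀⟩ : S.Nonempty := card_pos.1 (by omega)
    have hdom : ∀ v ∈ T, Dominates c v w := fun v hv => (hall v hv a₀ ha₀).1
    have hwT : w ∉ T := fun h => (hdom w h).1 rfl
    refine hno (hasRainbowCopy_completeBipartiteGraph_iff.2 ⟨insert w S, T, ?_, hT, ?_, ?_⟩)
    · obtain ⟨v, hv⟩ : T.Nonempty := card_pos.1 (by omega)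
      rw [card_insert_of_notMem fun h => (hall v hv w h).2.2.1 rfl, hS]
    · rw [disjoint_insert_left]
      exact ⟨hwT, Finset.disjoint_left.2 fun x hxS hxT => (hall x hxT x hxS).2.1.1 rfl⟩
    · have hmix : ∀ v ∈ T, ∀ a ∈ S, ∀ v' ∈ T, c s(w, v') ≠ c s(a, v) := by
        intro v hv a ha v' hv' heq
        rw [Sym2.eq_swap, Sym2.eq_swap (a := a)] at heq
        obtain ⟨-, hE, haw, hne⟩ := hall v hv a ha
        rcases hc.1 v' w v a (hdom v' hv').1 hE.1 heq with h | h | h | h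
        · subst h
          exact hne heq.symm
        · subst h
          exact (hall v' hv' v' ha).2.1.1 rfl
        · exact hwT (h ▸ hv)
        · exact haw h.symm
      intro a ha v hv a' ha' v' hv' heq
      rcases mem_insert.1 ha with rfl | haS <;> rcases mem_insert.1 ha' with rfl | haS'
      · refine ⟨rfl, (hdom v' hv').2 v (hdom v hv).1 ?_⟩
        rwa [Sym2.eq_swap, Sym2.eq_swap (a := v')]
      · exact absurd heq (hmix v' hv' a' haS' v hv)
      · exact absurd heq.symm (hmix v hv a haS v' hv')
      · rcases Sym2.eq_iff.1 (hinj a v a' v' (hsymm _ _ (hall v hv a haS).2.1)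
          (hsymm _ _ (hall v' hv' a' haS').2.1) heq) with h | ⟨h, -⟩
        · exact h
        · subst h
          exact absurd rfl (hall a hv' a haS).2.1.1
  have hmain := hc.sum_card_filter_le hsymm (fun v h => h.1 rfl) hinj hs hfree univ
  rw [card_univ] at hmain
  have hcard : colourCount c ≤ ∑ v : α, #{a : α | E v a} := by
    have h1 : c '' {e : Sym2 α | ¬ e.IsDiag} ⊆
        ((univ.filter fun q : α × α => E q.1 q.2).image fun q => c s(q.1, q.2) : Finset ℕ) := by
      intro k hk
      obtain ⟨hd, hk'⟩ := hrep k hk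
      induction hr : rep k using Sym2.ind with
      | _ u v =>
        rw [hr] at hd hk'
        simp only [coe_image, coe_filter, mem_univ, true_and, Set.mem_image, Set.mem_ofPred_eq]
        exact ⟨(u, v), ⟨by simpa using hd, by rw [hk', hr]⟩, hk'⟩
    have h2 := Set.ncard_le_ncard h1 (finite_toSet _)
    rw [Set.ncard_coe_finset] at h2
    refine h2.trans (card_image_le.trans ?_)
    rw [card_filter, ← univ_product_univ, sum_product]
    simp only [card_filter, le_refl]
  refine (Nat.cast_le.2 hcard).trans (le_trans (le_of_eq ?_) hmain)
  push_cast
  congr!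

end UpperBound

section LowerBound

open Finset

open Classical in
/-- The edges in `G` get pairwise distinct colours, the other edges are coloured lexically. -/
noncomputable def mixedColouring {n : ℕ} (G : Set (Sym2 (Fin n))) : EdgeColouring (Fin n) :=
  fun e => if e ∈ G then n + (Fintype.equivFin (Sym2 (Fin n)) e : ℕ) else lexColouring n e

variable {n : ℕ} {G : Set (Sym2 (Fin n))}

lemma lexColouring_lt (e : Sym2 (Fin n)) : lexColouring n e < n := by
  induction e using Sym2.ind with
  | _ a b => exact (min_le_left _ _).trans_lt a.2

lemma mixedColouring_of_notMem {a b : Fin n} (h : s(a, b) ∉ G) :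
    mixedColouring G s(a, b) = min a.1 b.1 := if_neg h

lemma mixedColouring_eq_of_mem {e f : Sym2 (Fin n)} (he : e ∈ G)
    (h : mixedColouring G e = mixedColouring G f) : e = f := by
  have hlt := lexColouring_lt f
  by_cases hf : f ∈ G
  · simp only [mixedColouring, if_pos he, if_pos hf] at h
    exact (Fintype.equivFin _).injective (Fin.ext (by omega))
  · simp only [mixedColouring, if_pos he, if_neg hf] at h
    omega

lemma isStarColouring_mixedColouring : IsStarColouring (mixedColouring G) := by
  constructor
  · intro a b x y hab hxy h
    by_cases h1 : s(a, b) ∈ G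
    · have := Sym2.eq_iff.1 (mixedColouring_eq_of_mem h1 h)
      tauto
    · by_cases h2 : s(x, y) ∈ G
      · have := Sym2.eq_iff.1 (mixedColouring_eq_of_mem h2 h.symm)
        tauto
      · rw [mixedColouring_of_notMem h1, mixedColouring_of_notMem h2] at h
        simp only [Fin.ext_iff]
        omega
  · rintro a b d hab hbd had ⟨h1, h2⟩
    by_cases h3 : s(a, b) ∈ G
    · have := Sym2.eq_iff.1 (mixedColouring_eq_of_mem h3 h1)
      tauto
    by_cases h4 : s(b, d) ∈ G
    · have := Sym2.eq_iff.1 (mixedColouring_eq_of_mem h4 h2)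
      tauto
    by_cases h5 : s(a, d) ∈ G
    · have := Sym2.eq_iff.1 (mixedColouring_eq_of_mem h5 h2.symm)
      tauto
    rw [mixedColouring_of_notMem h3, mixedColouring_of_notMem h4] at h1
    rw [mixedColouring_of_notMem h4, mixedColouring_of_notMem h5] at h2
    simp only [ne_eq, Fin.ext_iff] at hab hbd had
    omega

lemma ncard_le_colourCount_mixedColouring (hG : ∀ e ∈ G, ¬ e.IsDiag) :
    G.ncard ≤ colourCount (mixedColouring G) := by
  have hinj : Set.InjOn (mixedColouring G) G := fun e he f _ h => mixedColouring_eq_of_mem he h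
  rw [← hinj.ncard_image]
  exact Set.ncard_le_ncard (Set.image_mono hG) (Set.toFinite _)

/-- A rainbow `K_{s+1,t}` in the mixed colouring yields a large `K_{s,t'}` in `G`. -/
lemma not_hasRainbowCopy_mixedColouring {s D : ℕ}
    (hG : ∀ A T : Finset (Fin n), #A = s → (∀ a ∈ A, ∀ v ∈ T, s(a, v) ∈ G) → #T ≤ D) :
    ¬ HasRainbowCopy (mixedColouring G)
      (completeBipartiteGraph (Fin (s + 1)) (Fin ((s + 1) * (D + 2)))) := by
  classical
  rw [hasRainbowCopy_completeBipartiteGraph_iff]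
  rintro ⟨A, T, hA, hT, hd, hinj⟩
  have hne : ∀ a ∈ A, ∀ v ∈ T, a ≠ v := fun a ha v hv h =>
    Finset.disjoint_left.1 hd ha (h ▸ hv)
  set T₀ := {v ∈ T | ∃ a ∈ A, s(a, v) ∉ G ∧ a < v}
  have hcard : #T₀ ≤ #A := by
    have : ∀ v : Fin n, ∃ a, v ∈ T₀ → a ∈ A ∧ s(a, v) ∉ G ∧ a < v := by
      intro v
      by_cases hv : v ∈ T₀
      · obtain ⟨a, ha⟩ := (mem_filter.1 hv).2
        exact ⟨a, fun _ => ha⟩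
      · exact ⟨v, fun h => absurd h hv⟩
    choose g hg using this
    refine card_le_card_of_injOn g (fun v hv => (hg v hv).1) fun v hv v' hv' h => ?_
    obtain ⟨h1, h2, h3⟩ := hg v hv
    obtain ⟨h1', h2', h3'⟩ := hg v' hv'
    refine (hinj _ h1 v (mem_filter.1 hv).1 _ h1' v' (mem_filter.1 hv').1 ?_).2
    rw [mixedColouring_of_notMem h2, mixedColouring_of_notMem h2',
      min_eq_left (Fin.lt_def.1 h3).le, min_eq_left (Fin.lt_def.1 h3').le, h]
  obtain ⟨a₀, ha₀⟩ : A.Nonempty := card_pos.1 (by omega)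
  have hmiss : ∀ v : Fin n, ∃ b ∈ A, v ∈ T \ T₀ → ∀ a ∈ A, a ≠ b → s(a, v) ∈ G := by
    intro v
    by_cases hv : ∃ b ∈ A, s(b, v) ∉ G
    · obtain ⟨b, hb, hbv⟩ := hv
      refine ⟨b, hb, fun hvT a ha hab => ?_⟩
      by_contra hav
      obtain ⟨hvT, hvT₀⟩ := mem_sdiff.1 hvT
      have hlt : ∀ x ∈ A, s(x, v) ∉ G → v < x := fun x hx hxv =>
        lt_of_le_of_ne (not_lt.1 fun h => hvT₀ (mem_filter.2 ⟨hvT, x, hx, hxv, h⟩))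
          (hne x hx v hvT).symm
      refine hab (hinj a ha v hvT b hb v hvT ?_).1
      rw [mixedColouring_of_notMem hav, mixedColouring_of_notMem hbv,
        min_eq_right (Fin.lt_def.1 (hlt a ha hav)).le,
        min_eq_right (Fin.lt_def.1 (hlt b hb hbv)).le]
    · push Not at hv
      exact ⟨a₀, ha₀, fun _ a ha _ => hv a ha⟩
  choose g hgA hg using hmiss
  have hbig : #A * D < #(T \ T₀) := by
    have h1 := le_card_sdiff T₀ T
    rw [hT] at h1
    rw [hA] at hcard ⊢
    have : (s + 1) * (D + 2) = (s + 1) * D + 2 * (s + 1) := by ring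
    omega
  obtain ⟨b, hb, hlt⟩ := exists_lt_card_fiber_of_mul_lt_card_of_maps_to
    (fun v _ => hgA v) hbig
  refine absurd (hG (A.erase b) _ (by rw [card_erase_of_mem hb, hA]; rfl) ?_) (not_le.2 hlt)
  intro a ha v hv
  obtain ⟨hvT, rfl⟩ := mem_filter.1 hv
  exact hg v hvT a (mem_of_mem_erase ha) (ne_of_mem_erase ha)

/-- The edges of the bipartite graph of a relation `R` placed inside `K_n`. -/
def relEdges {F : Type*} (R : Finset (F × F)) (l r : F ↪ Fin n) : Set (Sym2 (Fin n)) :=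
  (fun q : F × F => s(l q.1, r q.2)) '' R

section

variable {F : Type*} {R : Finset (F × F)} {l r : F ↪ Fin n}

lemma mem_relEdges_left (hlr : ∀ x y, l x ≠ r y) {x : F} {v : Fin n} :
    s(l x, v) ∈ relEdges R l r ↔ ∃ y, (x, y) ∈ R ∧ r y = v := by
  constructor
  · rintro ⟨⟨x', y⟩, hR, h⟩
    rcases Sym2.eq_iff.1 h with ⟨h1, h2⟩ | ⟨-, h2⟩
    · obtain rfl := l.injective h1
      exact ⟨y, hR, h2⟩
    · exact absurd h2.symm (hlr _ _)
  · rintro ⟨y, hR, rfl⟩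
    exact ⟨(x, y), hR, rfl⟩

lemma mem_relEdges_right (hlr : ∀ x y, l x ≠ r y) {y : F} {v : Fin n} :
    s(r y, v) ∈ relEdges R l r ↔ ∃ x, (x, y) ∈ R ∧ l x = v := by
  constructor
  · rintro ⟨⟨x, y'⟩, hR, h⟩
    rcases Sym2.eq_iff.1 h with ⟨h1, -⟩ | ⟨h1, h2⟩
    · exact absurd h1 (hlr _ _)
    · obtain rfl := r.injective h2
      exact ⟨x, hR, h1⟩
  · rintro ⟨x, hR, rfl⟩
    exact ⟨(x, y), hR, Sym2.eq_swap⟩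

lemma card_le_of_biclique_relEdges (hlr : ∀ x y, l x ≠ r y) {s D : ℕ} (hs : 1 ≤ s)
    (hR : ∀ X Y : Finset F, #Y = s → (∀ x ∈ X, ∀ y ∈ Y, (x, y) ∈ R) → #X ≤ D)
    (hR' : ∀ X Y : Finset F, #X = s → (∀ x ∈ X, ∀ y ∈ Y, (x, y) ∈ R) → #Y ≤ D)
    (A T : Finset (Fin n)) (hA : #A = s) (h : ∀ a ∈ A, ∀ v ∈ T, s(a, v) ∈ relEdges R l r) :
    #T ≤ D := by
  classical
  rcases T.eq_empty_or_nonempty with rfl | ⟨v₀, hv₀⟩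
  · simp
  obtain ⟨a₀, ha₀⟩ : A.Nonempty := card_pos.1 (by omega)
  have key : ∀ (f g : F ↪ Fin n) (Q : F → F → Prop) (x₀ y₀ : F), f x₀ = a₀ → g y₀ = v₀ →
      (∀ x v, s(f x, v) ∈ relEdges R l r ↔ ∃ y, Q x y ∧ g y = v) →
      (∀ y v, s(g y, v) ∈ relEdges R l r ↔ ∃ x, Q x y ∧ f x = v) →
      (∀ X Y : Finset F, #X = s → (∀ x ∈ X, ∀ y ∈ Y, Q x y) → #Y ≤ D) → #T ≤ D := by
    intro f g Q x₀ y₀ hx₀ hy₀ hf hg hQ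
    have hAf : ∀ a ∈ A, ∃ x, f x = a := by
      intro a ha
      have := h a ha v₀ hv₀
      rw [Sym2.eq_swap, ← hy₀, hg] at this
      exact this.imp fun _ h => h.2
    have hTg : ∀ v ∈ T, ∃ y, g y = v := by
      intro v hv
      have := h a₀ ha₀ v hv
      rw [← hx₀, hf] at this
      exact this.imp fun _ h => h.2
    have hAX : (A.preimage f f.injective.injOn).map f = A := by
      ext a
      simp only [mem_map, mem_preimage]
      exact ⟨by rintro ⟨x, hx, rfl⟩; exact hx, fun ha => by
        obtain ⟨x, rfl⟩ := hAf a ha; exact ⟨x, ha, rfl⟩⟩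
    have hTY : (T.preimage g g.injective.injOn).map g = T := by
      ext v
      simp only [mem_map, mem_preimage]
      exact ⟨by rintro ⟨y, hy, rfl⟩; exact hy, fun hv => by
        obtain ⟨y, rfl⟩ := hTg v hv; exact ⟨y, hv, rfl⟩⟩
    rw [← hTY, card_map]
    refine hQ (A.preimage f f.injective.injOn) _ (by rw [← hA, ← card_map f, hAX]) ?_
    intro x hx y hy
    obtain ⟨y', hxy, hy'⟩ := (hf x (g y)).1 (h _ (mem_preimage.1 hx) _ (mem_preimage.1 hy))
    rwa [g.injective hy'] at hxy
  obtain ⟨⟨x, y⟩, hxy, h0⟩ := h a₀ ha₀ v₀ hv₀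
  rcases Sym2.eq_iff.1 h0 with ⟨h1, h2⟩ | ⟨h1, h2⟩
  · exact key l r (fun x y => (x, y) ∈ R) x y h1 h2 (fun _ _ => mem_relEdges_left hlr)
      (fun _ _ => mem_relEdges_right hlr) hR'
  · exact key r l (fun y x => (x, y) ∈ R) y x h2 h1 (fun _ _ => mem_relEdges_right hlr)
      (fun _ _ => mem_relEdges_left hlr) fun X Y hX hXY => hR Y X hX fun y hy x hx => hXY x hx y hy

lemma ncard_relEdges (hlr : ∀ x y, l x ≠ r y) : (relEdges R l r).ncard = #R := by
  rw [relEdges, Set.ncard_image_of_injective, Set.ncard_coe_finset]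
  rintro ⟨x, y⟩ ⟨x', y'⟩ h
  rcases Sym2.eq_iff.1 h with ⟨h1, h2⟩ | ⟨h1, -⟩
  · exact Prod.ext (l.injective h1) (r.injective h2)
  · exact absurd h1 (hlr _ _)

end

lemma exists_starColouring_of_prime {s p n : ℕ} (hs : 1 ≤ s) (hp : p.Prime) (hn : 2 * p ^ s ≤ n) :
    ∃ c : EdgeColouring (Fin n), IsStarColouring c ∧ p ^ (2 * s - 1) ≤ colourCount c ∧
      ¬ HasRainbowCopy c
        (completeBipartiteGraph (Fin (s + 1)) (Fin ((s + 1) * (s.factorial + 2)))) := by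
  obtain ⟨F, _, R, hF, hRc, hR, hR'⟩ := exists_dense_relation hs p hp
  obtain ⟨f⟩ : Nonempty (F ⊕ F ↪ Fin n) :=
    Function.Embedding.nonempty_of_card_le (by simp [hF]; omega)
  let l := Function.Embedding.inl.trans f
  let r := Function.Embedding.inr.trans f
  have hlr : ∀ x y, l x ≠ r y := fun x y h => Sum.inl_ne_inr (f.injective h)
  refine ⟨mixedColouring (relEdges R l r), isStarColouring_mixedColouring, ?_,
    not_hasRainbowCopy_mixedColouring (card_le_of_biclique_relEdges hlr hs hR hR')⟩
  refine hRc.trans ((ncard_relEdges hlr).symm.le.trans (ncard_le_colourCount_mixedColouring ?_))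
  rintro _ ⟨q, -, rfl⟩
  simpa using hlr _ _

lemma exists_prime_pow_between {s n : ℕ} (hs : 1 ≤ s) (hn : 2 * 2 ^ s ≤ n) :
    ∃ p : ℕ, p.Prime ∧ 2 * p ^ s ≤ n ∧
      (1 / 4) ^ (2 * s - 1) * (1 / 2) ^ (2 - 1 / (s : ℝ)) * (n : ℝ) ^ (2 - 1 / (s : ℝ)) ≤
        (p : ℝ) ^ (2 * s - 1) := by
  have hsR : (s : ℝ) ≠ 0 := by positivity
  set z : ℝ := (1 / 2 * (n : ℝ)) ^ (1 / (s : ℝ)) with hz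
  have hz0 : 0 ≤ z := by positivity
  have hzs : z ^ s = 1 / 2 * n := by
    rw [hz, one_div (s : ℝ), Real.rpow_inv_natCast_pow (by positivity) (by omega)]
  have hz2 : 2 ≤ z := by
    refine le_of_pow_le_pow_left₀ (n := s) (by omega) hz0 ?_
    rw [hzs]
    have : (2 * 2 ^ s : ℝ) ≤ n := by exact_mod_cast hn
    linarith
  have hk1 : 1 ≤ ⌊z / 2⌋₊ := Nat.le_floor (by rw [Nat.cast_one]; linarith)
  obtain ⟨p, hp, hlt, hle⟩ := Nat.exists_prime_lt_and_le_two_mul ⌊z / 2⌋₊ (by omega)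
  refine ⟨p, hp, ?_, ?_⟩
  · have h1 : (p : ℝ) ≤ z := by
      have h2 : (p : ℝ) ≤ 2 * ⌊z / 2⌋₊ := by exact_mod_cast hle
      have := Nat.floor_le (div_nonneg hz0 zero_le_two)
      linarith
    have h2 : (p : ℝ) ^ s ≤ z ^ s := by gcongr
    rw [hzs] at h2
    have : (2 * p ^ s : ℝ) ≤ n := by linarith
    exact_mod_cast this
  · have h1 : 1 / 4 * z ≤ p := by
      have h2 : (⌊z / 2⌋₊ + 1 : ℝ) ≤ p := by exact_mod_cast hlt
      have := Nat.lt_floor_add_one (z / 2)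
      linarith
    refine le_trans (le_of_eq ?_) (pow_le_pow_left₀ (by positivity) h1 (2 * s - 1))
    rw [mul_pow, mul_assoc, ← Real.mul_rpow (by norm_num) (by positivity), hz,
      ← Real.rpow_natCast (_ ^ _), ← Real.rpow_mul (by positivity), Nat.cast_sub (by omega)]
    congr 2
    push_cast
    field_simp

end LowerBound

section StarAntiRamsey

variable {n : ℕ} {β : Type*} {H : SimpleGraph β}

lemma colourCount_le_card (c : EdgeColouring (Fin n)) :
    colourCount c ≤ Nat.card (Sym2 (Fin n)) :=
  (Set.ncard_image_le (Set.toFinite _)).trans (Set.ncard_le_card _)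

lemma colourCount_le_starAntiRamsey {c : EdgeColouring (Fin n)} (hc : IsStarColouring c)
    (h : ¬ HasRainbowCopy c H) : colourCount c ≤ starAntiRamsey n H :=
  le_csSup ⟨Nat.card (Sym2 (Fin n)), by rintro _ ⟨c, -, rfl, -⟩; exact colourCount_le_card c⟩
    ⟨c, hc, rfl, h⟩

lemma starAntiRamsey_le {B : ℝ} (hB : 0 ≤ B) (h : ∀ c : EdgeColouring (Fin n),
    IsStarColouring c → ¬ HasRainbowCopy c H → (colourCount c : ℝ) ≤ B) :
    (starAntiRamsey n H : ℝ) ≤ B := by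
  have : starAntiRamsey n H ≤ ⌊B⌋₊ :=
    csSup_le' (by rintro _ ⟨c, hc, rfl, hH⟩; exact Nat.le_floor (h c hc hH))
  exact (Nat.cast_le.2 this).trans (Nat.floor_le hB)

end StarAntiRamsey

/-- For every integer `s ≥ 1` the exponent `2 - 1/s` is star realisable: there are a
graph `H` and constants `c₁, c₂ > 0` with
`c₁·n^{2-1/s} ≤ ar*(n, H) ≤ c₂·n^{2-1/s}` for all sufficiently large `n`. -/
theorem starRealisable (s : ℕ) (hs : 1 ≤ s) :
    ∃ (m : ℕ) (H : SimpleGraph (Fin m)) (c₁ c₂ : ℝ), 0 < c₁ ∧ 0 < c₂ ∧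
      ∃ n₀ : ℕ, ∀ n : ℕ, n₀ ≤ n →
        c₁ * (n : ℝ) ^ (2 - 1 / (s : ℝ)) ≤ (starAntiRamsey n H : ℝ) ∧
        (starAntiRamsey n H : ℝ) ≤ c₂ * (n : ℝ) ^ (2 - 1 / (s : ℝ)) := by
  refine ⟨s + 1 + (s + 1) * (s.factorial + 2),
    (completeBipartiteGraph (Fin (s + 1)) (Fin ((s + 1) * (s.factorial + 2)))).comap
      finSumFinEquiv.symm,
    (1 / 4) ^ (2 * s - 1) * (1 / 2) ^ (2 - 1 / (s : ℝ)),
    32 * (s + ((s + 1) * (s.factorial + 2) : ℕ) + 2), by positivity, by positivity,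
    2 * 2 ^ s, fun n hn => ⟨?_, ?_⟩⟩
  · obtain ⟨p, hp, hpn, hle⟩ := exists_prime_pow_between hs hn
    obtain ⟨c, hc, hcount, hno⟩ := exists_starColouring_of_prime hs hp hpn
    refine hle.trans ?_
    exact_mod_cast hcount.trans (colourCount_le_starAntiRamsey hc
      (mt (HasRainbowCopy.comap_equiv_iff _).1 hno))
  · refine starAntiRamsey_le (by positivity) fun c hc hno => ?_
    have := hc.colourCount_le hs (Nat.mul_pos s.succ_pos (Nat.succ_pos _))
      (mt (HasRainbowCopy.comap_equiv_iff _).2 hno)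
    rwa [Fintype.card_fin] at this
end

section
/- For every integer n ≥ 1, the lexical colouring of K_n contains a rainbow copy of every forest on at most n vertices. -/
open SimpleGraph

/-- In a tree, a vertex has at most one neighbour that is no further from the root than itself. -/
theorem SimpleGraph.IsTree.eq_of_adj_of_dist_le {V : Type*} {T : SimpleGraph V} (hT : T.IsTree)
    (r : V) {u v w : V} (huv : T.Adj u v) (huw : T.Adj u w)
    (hv : T.dist r v ≤ T.dist r u) (hw : T.dist r w ≤ T.dist r u) : v = w := by
  have penultimate_eq (p : T.Walk r u) (hp : p.IsPath) (x : V) (hux : T.Adj u x)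
      (hx : T.dist r x ≤ T.dist r u) : x = p.penultimate := by
    obtain ⟨q, hq⟩ := hT.connected.exists_walk_length_eq_dist r x
    have hd : T.dist r u = T.dist r x + 1 := by
      have := hT.dist_ne_of_adj r hux
      have := hT.dist_eq_dist_add_one_of_adj r hux
      omega
    have hqp : (q.concat hux.symm).IsPath :=
      Walk.isPath_of_length_eq_dist _ (by rw [Walk.length_concat, hq, hd])
    obtain rfl : p = q.concat hux.symm :=
      congrArg Subtype.val ((hT.isAcyclic.subsingleton_path r u).elim ⟨p, hp⟩ ⟨_, hqp⟩)
    simp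
  obtain ⟨p, hp, -⟩ := hT.connected.exists_path_of_dist r u
  rw [penultimate_eq p hp v huv hv, penultimate_eq p hp w huw hw]

/-- If every vertex has at most one neighbour that is placed after it, then the placement is
rainbow in the lexical colouring. -/
theorem hasRainbowCopy_lexColouring_of_embedding {n : ℕ} {β : Type*} {G : SimpleGraph β}
    (f : β ↪ Fin n)
    (hf : ∀ u v w, G.Adj u v → G.Adj u w → f u < f v → f u < f w → v = w) :
    HasRainbowCopy (lexColouring n) G := by
  have exists_lower (u v : β) (h : G.Adj u v) : ∃ a b, s(u, v) = s(a, b) ∧ G.Adj a b ∧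
      f a < f b ∧ lexColouring n s(f u, f v) = f a := by
    rcases lt_or_gt_of_ne (f.injective.ne h.ne) with hlt | hlt
    · exact ⟨u, v, rfl, h, hlt, min_eq_left hlt.le⟩
    · exact ⟨v, u, Sym2.eq_swap, h.symm, hlt, min_eq_right hlt.le⟩
  refine ⟨f, fun u v x y huv hxy hne heq => hne ?_⟩
  obtain ⟨a, b, hab, hadj, hlt, hcol⟩ := exists_lower u v huv
  obtain ⟨a', b', hab', hadj', hlt', hcol'⟩ := exists_lower x y hxy
  obtain rfl : a = a' := f.injective (Fin.ext (hcol.symm.trans (heq.trans hcol')))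
  rw [hab, hab', hf a b b' hadj hadj' hlt hlt']

/-- The lexical colouring of `K_n` contains a rainbow copy of every forest on at most
`n` vertices. -/
theorem lexColouring_rainbow_forest (n : ℕ) (hn : 1 ≤ n) (m : ℕ) (hm : m ≤ n)
    (F : SimpleGraph (Fin m)) (hF : F.IsAcyclic) :
    HasRainbowCopy (lexColouring n) F := by
  rcases Nat.eq_zero_or_pos m with rfl | hpos
  · exact ⟨Fin.castLEEmb hm, fun u => u.elim0⟩
  have : NeZero m := ⟨hpos.ne'⟩
  obtain ⟨T, hFT, -, hT⟩ :=
    (connected_top (V := Fin m)).exists_isTree_le_of_le_of_isAcyclic le_top hF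
  let σ := Tuple.sort (T.dist 0)
  have dist_le (u v : Fin m) (h : (σ.symm u).rev < (σ.symm v).rev) : T.dist 0 v ≤ T.dist 0 u := by
    simpa [σ] using Tuple.monotone_sort (T.dist 0) (Fin.rev_lt_rev.mp h).le
  refine hasRainbowCopy_lexColouring_of_embedding
    ((σ.symm.trans Fin.revPerm).toEmbedding.trans (Fin.castLEEmb hm)) fun u v w huv huw hv hw => ?_
  exact hT.eq_of_adj_of_dist_le 0 (hFT huv) (hFT huw) (dist_le u v hv) (dist_le u w hw)
end

section
/- For every integer n ≥ 3, the lexical colouring of K_n contains no rainbow cycle; moreover, it is the unique star-colouring of K_n with n - 1 colours containing no rainbow cycle, i.e. every star-colouring of K_n with exactly n - 1 colours and no rainbow cycle is a lexical colouring with respect to some ordering of the vertices. -/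
open SimpleGraph

theorem lexColouring_not_hasRainbowCopy_cycleGraph (n k : ℕ) (hk : 3 ≤ k) :
    ¬ HasRainbowCopy (lexColouring n) (cycleGraph k) := by
  obtain ⟨m, rfl⟩ : ∃ m, k = m + 3 := ⟨k - 3, by omega⟩
  rintro ⟨f, hf⟩
  obtain ⟨u, -, hu⟩ := Finset.exists_min_image Finset.univ (fun x => (f x).1)
    Finset.univ_nonempty
  have hne : s(u, u + 1) ≠ s(u, u - 1) := by
    intro h
    have h2 : u + 1 = u - 1 := by simpa using h
    have h3 : (1 : Fin (m + 3)) + 1 = 0 := by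
      have h4 := congrArg (fun x => x - u + 1) h2
      simpa [add_comm, add_left_comm, sub_eq_add_neg] using h4
    simp [Fin.ext_iff, Fin.val_add, Nat.mod_eq_of_lt] at h3
  refine hf u (u + 1) u (u - 1) ?_ ?_ hne ?_
  · simp [cycleGraph_adj]
  · simp [cycleGraph_adj]
  · simp [lexColouring, min_eq_left (hu (u + 1) (Finset.mem_univ _)),
      min_eq_left (hu (u - 1) (Finset.mem_univ _))]

theorem eq_or_eq_or_eq_of_not_hasRainbowCopy_cycleGraph_three {α : Type*} {c : EdgeColouring α}
    (h : ¬ HasRainbowCopy c (cycleGraph 3)) {x y z : α} (hxy : x ≠ y) (hyz : y ≠ z)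
    (hxz : x ≠ z) :
    c s(x, y) = c s(x, z) ∨ c s(x, y) = c s(y, z) ∨ c s(x, z) = c s(y, z) := by
  by_contra! hc
  obtain ⟨h1, h2, h3⟩ := hc
  refine h ⟨⟨![x, y, z], ?_⟩, ?_⟩
  · intro i j hij
    fin_cases i <;> fin_cases j <;> simp_all
  · intro p q r s hpq hrs hne
    have hpq' := hpq.ne
    have hrs' := hrs.ne
    have hyx : s(y, x) = s(x, y) := Sym2.eq_swap
    have hzx : s(z, x) = s(x, z) := Sym2.eq_swap
    have hzy : s(z, y) = s(y, z) := Sym2.eq_swap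
    change c s(![x, y, z] p, ![x, y, z] q) ≠ c s(![x, y, z] r, ![x, y, z] s)
    fin_cases p <;> fin_cases q <;> first | exact absurd rfl hpq' | skip
    all_goals fin_cases r <;> fin_cases s <;> first | exact absurd rfl hrs' | skip
    all_goals first
      | exact absurd rfl hne
      | exact absurd Sym2.eq_swap hne
      | simp [hyx, hzx, hzy, h1, h2, h3, h1.symm, h2.symm, h3.symm]

theorem IsStarColouring.exists_dominating {α : Type*} {c : EdgeColouring α}
    (hc : IsStarColouring c) (h : ¬ HasRainbowCopy c (cycleGraph 3)) {S : Finset α}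
    (hS : S.Nonempty) :
    ∃ v ∈ S, ∀ x ∈ S, ∀ y ∈ S, x ≠ v → y ≠ v → c s(v, x) = c s(v, y) := by
  classical
  rcases S.offDiag.eq_empty_or_nonempty with hE | hE
  · obtain ⟨v, hv⟩ := hS
    refine ⟨v, hv, fun x hx y _ hxv _ => ?_⟩
    have hmem : (x, v) ∈ S.offDiag := Finset.mem_offDiag.2 ⟨hx, hv, hxv⟩
    simp [hE] at hmem
  let N : α → ℕ → Finset α := fun v m => {x ∈ S | x ≠ v ∧ c s(v, x) = m}
  have mem_N {v m x} : x ∈ N v m ↔ x ∈ S ∧ x ≠ v ∧ c s(v, x) = m := Finset.mem_filter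
  obtain ⟨⟨v, u⟩, hvu, hmax⟩ := Finset.exists_max_image S.offDiag
    (fun p => (N p.1 (c s(p.1, p.2))).card) hE
  obtain ⟨hv, hu, hne⟩ := Finset.mem_offDiag.1 hvu
  simp only at hv hu hne hmax
  replace hmax : ∀ a ∈ S, ∀ b ∈ S, a ≠ b → (N a (c s(a, b))).card ≤ (N v (c s(v, u))).card :=
    fun a ha b hb hab => hmax (a, b) (Finset.mem_offDiag.2 ⟨ha, hb, hab⟩)
  suffices key : ∀ w ∈ S, w ≠ v → c s(v, w) = c s(v, u) from
    ⟨v, hv, fun x hx y hy hxv hyv => (key x hx hxv).trans (key y hy hyv).symm⟩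
  intro w hw hwv
  by_contra hcw
  have hsub : insert v (N v (c s(v, u))) ⊆ N w (c s(w, v)) := by
    intro x hx
    rcases Finset.mem_insert.1 hx with rfl | hxN
    · exact mem_N.2 ⟨hv, hwv.symm, rfl⟩
    obtain ⟨hxS, hxv, hcx⟩ := mem_N.1 hxN
    have hxw : x ≠ w := by
      rintro rfl
      exact hcw hcx
    refine mem_N.2 ⟨hxS, hxw, ?_⟩
    rcases eq_or_eq_or_eq_of_not_hasRainbowCopy_cycleGraph_three h hxv.symm hxw hwv.symm with
      h1 | h1 | h1
    · exact absurd (h1.symm.trans hcx) hcw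
    · exfalso
      have hpair : ({v, w} : Finset α) ⊆ N x (c s(x, v)) := by
        intro y hy
        rcases Finset.mem_insert.1 hy with rfl | hy
        · exact mem_N.2 ⟨hv, hxv.symm, rfl⟩
        · rw [Finset.mem_singleton.1 hy]
          exact mem_N.2 ⟨hw, hxw.symm, by rw [← h1, Sym2.eq_swap]⟩
      have hcard : 1 < (N v (c s(v, u))).card :=
        calc 1 < ({v, w} : Finset α).card := by simp [Finset.card_pair hwv.symm]
          _ ≤ _ := Finset.card_le_card hpair
          _ ≤ _ := hmax x hxS v hv hxv
      obtain ⟨z, hzN, hzx⟩ := Finset.exists_mem_ne hcard x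
      obtain ⟨-, hzv, hcz⟩ := mem_N.1 hzN
      have hzw : z ≠ w := by
        rintro rfl
        exact hcw hcz
      rcases hc.1 v z x w hzv.symm hxw (by rw [hcz, ← h1, hcx]) with h2 | h2 | h2 | h2
      · exact hxv h2.symm
      · exact hwv h2.symm
      · exact hzx h2
      · exact hzw h2
    · rw [Sym2.eq_swap, ← h1, Sym2.eq_swap]
  have hvN : v ∉ N v (c s(v, u)) := fun hvN => (mem_N.1 hvN).2.1 rfl
  have hle := (Finset.card_le_card hsub).trans (hmax w hw v hv hwv)
  rw [Finset.card_insert_of_notMem hvN] at hle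
  omega

theorem IsStarColouring.exists_rank {α : Type*} {c : EdgeColouring α}
    (hc : IsStarColouring c) (h : ¬ HasRainbowCopy c (cycleGraph 3)) (S : Finset α) :
    ∃ r : α → ℕ, Set.InjOn r S ∧ ∀ x ∈ S, ∀ y ∈ S, ∀ z ∈ S, r x < r y → r x < r z →
      c s(x, y) = c s(x, z) := by
  classical
  induction S using Finset.strongInduction with
  | H S ih =>
    rcases S.eq_empty_or_nonempty with rfl | hS
    · exact ⟨fun _ => 0, by simp⟩
    obtain ⟨v, hv, hdom⟩ := hc.exists_dominating h hS
    obtain ⟨r, hinj, hr⟩ := ih _ (Finset.erase_ssubset hv)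
    refine ⟨fun x => if x = v then 0 else r x + 1, ?_, ?_⟩
    · intro x hx y hy hxy
      by_cases hxv : x = v <;> by_cases hyv : y = v <;> simp [hxv, hyv] at hxy ⊢
      exact hinj (by simpa [hxv] using hx) (by simpa [hyv] using hy) hxy
    · intro x hx y hy z hz hxy hxz
      have hyv : y ≠ v := by
        rintro rfl
        simp at hxy
      have hzv : z ≠ v := by
        rintro rfl
        simp at hxz
      by_cases hxv : x = v
      · subst hxv
        exact hdom y hy z hz hyv hzv
      · simp only [hxv, hyv, hzv, if_false, Nat.add_lt_add_iff_right] at hxy hxz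
        exact hr x (Finset.mem_erase.2 ⟨hxv, hx⟩) y (Finset.mem_erase.2 ⟨hyv, hy⟩) z
          (Finset.mem_erase.2 ⟨hzv, hz⟩) hxy hxz

theorem IsStarColouring.isLexical {n : ℕ} {c : EdgeColouring (Fin n)}
    (hc : IsStarColouring c) (h : ¬ HasRainbowCopy c (cycleGraph 3)) : IsLexical c := by
  obtain ⟨r, hinj, hr⟩ := hc.exists_rank h Finset.univ
  replace hinj : Function.Injective r := by simpa [Set.injOn_univ] using hinj
  have hmono : StrictMono (r ∘ Tuple.sort r) :=
    (Tuple.monotone_sort r).strictMono_of_injective (hinj.comp (Tuple.sort r).injective)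
  generalize Tuple.sort r = v at hmono
  have hv {i j k : Fin n} (hij : i < j) (hik : i < k) : c s(v i, v j) = c s(v i, v k) :=
    hr _ (Finset.mem_univ _) _ (Finset.mem_univ _) _ (Finset.mem_univ _) (hmono hij) (hmono hik)
  have hlt {i j k l : Fin n} (hij : i < j) (hkl : k < l) (hik : i < k) :
      c s(v i, v j) ≠ c s(v k, v l) := fun he =>
    hc.2 (v i) (v k) (v l) (v.injective.ne hik.ne) (v.injective.ne hkl.ne)
      (v.injective.ne (hik.trans hkl).ne)
      ⟨(hv hik hij).trans he, he.symm.trans (hv hij (hik.trans hkl))⟩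
  refine ⟨v, fun i j k l hij hkl => ⟨fun he => ?_, ?_⟩⟩
  · rcases lt_trichotomy i k with hik | hik | hik
    · exact absurd he (hlt hij hkl hik)
    · exact hik
    · exact absurd he.symm (hlt hkl hij hik)
  · rintro rfl
    exact hv hij hkl

/-- The lexical colouring of `K_n` (`n ≥ 3`) has no rainbow cycle, and it is the unique
star-colouring of `K_n` with `n - 1` colours with this property: every star-colouring
of `K_n` with exactly `n - 1` colours and no rainbow cycle is lexical with respect to
some ordering of the vertices. -/
theorem lexColouring_no_rainbow_cycle_unique (n : ℕ) (hn : 3 ≤ n) :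
    (∀ k : ℕ, 3 ≤ k → ¬ HasRainbowCopy (lexColouring n) (SimpleGraph.cycleGraph k)) ∧
    ∀ c : EdgeColouring (Fin n), IsStarColouring c → colourCount c = n - 1 →
      (∀ k : ℕ, 3 ≤ k → ¬ HasRainbowCopy c (SimpleGraph.cycleGraph k)) →
      IsLexical c := by
  exact ⟨fun k hk => lexColouring_not_hasRainbowCopy_cycleGraph n k hk,
    fun c hc _ h => hc.isLexical (h 3 le_rfl)⟩
end

section
/- For all integers t ≥ 2, nsar(P_{t-1}) = t, where P_{t-1} is the path with t - 1 edges (on t vertices); that is, every star-colouring of K_t contains a rainbow copy of P_{t-1}, and t is the minimum integer with this property. -/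
open SimpleGraph

/-- The walk along the list is properly coloured: consecutive edges get distinct colours. -/
def IsProperWalk {α : Type*} (c : EdgeColouring α) : List α → Prop
  | a :: b :: d :: l => c s(a, b) ≠ c s(b, d) ∧ IsProperWalk c (b :: d :: l)
  | _ => True

theorem IsProperWalk.getElem_ne {α : Type*} {c : EdgeColouring α} :
    ∀ {l : List α}, IsProperWalk c l → ∀ (i : ℕ) (hi : i + 2 < l.length),
      c s(l[i], l[i + 1]) ≠ c s(l[i + 1], l[i + 2])
  | _ :: _ :: _ :: _, h, 0, _ => h.1
  | _ :: _ :: _ :: _, h, i + 1, hi => h.2.getElem_ne i (by simpa using hi)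

/-- If `x` cannot be put in front of `a :: b :: l`, then it can be inserted after `a`, keeping
the colour of the first edge. -/
theorem IsProperWalk.exists_insert {α : Type*} {c : EdgeColouring α}
    (hc : ∀ a b d : α, a ≠ b → b ≠ d → a ≠ d →
      ¬(c s(a, b) = c s(b, d) ∧ c s(b, d) = c s(a, d)))
    {x : α} : ∀ {l : List α} {a b : α}, IsProperWalk c (a :: b :: l) →
      (x :: a :: b :: l).Nodup → c s(x, a) = c s(a, b) →
      ∃ y l', (y :: l').Perm (x :: b :: l) ∧ c s(a, y) = c s(a, b) ∧
        IsProperWalk c (a :: y :: l')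
  | l, a, b, h, hnd, hxa => by
    have hne : c s(a, x) ≠ c s(x, b) := by
      intro hab
      refine hc a x b ?_ ?_ ?_ ⟨hab, ?_⟩
      · rintro rfl; simp at hnd
      · rintro rfl; simp at hnd
      · rintro rfl; simp at hnd
      · rw [← hab, Sym2.eq_swap, hxa]
    have hax : c s(a, x) = c s(a, b) := by rw [Sym2.eq_swap, hxa]
    match l with
    | [] => exact ⟨x, [b], .refl _, hax, hne, trivial⟩
    | d :: l =>
      by_cases hbd : c s(x, b) = c s(b, d)
      · obtain ⟨y, l', hp, hy, hw⟩ := exists_insert hc h.2 (by simp at hnd ⊢; tauto) hbd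
        exact ⟨b, y :: l', (hp.cons b).trans (.swap _ _ _), rfl, by rw [hy]; exact h.1, hw⟩
      · exact ⟨x, b :: d :: l, .refl _, hax, hne, hbd, h.2⟩

/-- Without monochromatic triangles, every finite set of vertices is spanned by a properly
coloured path. -/
theorem exists_perm_isProperWalk {α : Type*} {c : EdgeColouring α}
    (hc : ∀ a b d : α, a ≠ b → b ≠ d → a ≠ d →
      ¬(c s(a, b) = c s(b, d) ∧ c s(b, d) = c s(a, d))) :
    ∀ l : List α, l.Nodup → ∃ l', l'.Perm l ∧ IsProperWalk c l'
  | [], _ => ⟨[], .refl _, trivial⟩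
  | x :: l, hnd => by
    obtain ⟨l', hp, hw⟩ := exists_perm_isProperWalk hc l hnd.of_cons
    have hnd' : (x :: l').Nodup := (hp.cons x).nodup_iff.2 hnd
    match l' with
    | [] => exact ⟨[x], hp.cons x, trivial⟩
    | [a] => exact ⟨[x, a], hp.cons x, trivial⟩
    | a :: b :: l' =>
      by_cases h : c s(x, a) = c s(a, b)
      · obtain ⟨y, m, hm, -, hwm⟩ := hw.exists_insert hc hnd' h
        exact ⟨a :: y :: m, ((hm.cons a).trans (.swap _ _ _)).trans (hp.cons x), hwm⟩
      · exact ⟨x :: a :: b :: l', hp.cons x, h, hw⟩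

/-- In a star-colouring, a properly coloured path is rainbow. -/
theorem IsStarColouring.hasRainbowCopy_pathGraph {α : Type*} {c : EdgeColouring α}
    (hc : IsStarColouring c) {l : List α} (hnd : l.Nodup) (hw : IsProperWalk c l) :
    HasRainbowCopy c (SimpleGraph.pathGraph l.length) := by
  have hlt : ∀ (i j : ℕ) (_ : i < j) (hj : j + 1 < l.length),
      c s(l[i], l[i + 1]) ≠ c s(l[j], l[j + 1]) := by
    intro i j hij hj h
    have key := hc.1 _ _ _ _ (by simp [hnd.getElem_inj_iff]) (by simp [hnd.getElem_inj_iff]) h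
    simp only [hnd.getElem_inj_iff] at key
    obtain rfl : j = i + 1 := by omega
    exact hw.getElem_ne i hj h
  have hedge : ∀ u v : Fin l.length, (SimpleGraph.pathGraph l.length).Adj u v →
      ∃ (i : ℕ) (hi : i + 1 < l.length),
        s(u, v) = s(⟨i, by omega⟩, ⟨i + 1, hi⟩) ∧ s(l[u], l[v]) = s(l[i], l[i + 1]) := by
    rintro ⟨u, hu⟩ ⟨v, hv⟩ h
    rw [SimpleGraph.pathGraph_adj] at h
    rcases h with h | h <;> dsimp only at h <;> subst h
    · exact ⟨u, hv, rfl, rfl⟩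
    · exact ⟨v, hu, Sym2.eq_swap, Sym2.eq_swap⟩
  refine ⟨⟨fun i => l[i], fun i j h => Fin.ext (hnd.getElem_inj_iff.1 h)⟩, ?_⟩
  intro u v x y huv hxy hne
  obtain ⟨i, hi, hi₁, hi₂⟩ := hedge u v huv
  obtain ⟨j, hj, hj₁, hj₂⟩ := hedge x y hxy
  change c s(l[u], l[v]) ≠ c s(l[x], l[y])
  rw [hi₂, hj₂]
  rcases lt_trichotomy i j with h | rfl | h
  · exact hlt i j h hj
  · exact absurd (hi₁.trans hj₁.symm) hne
  · exact (hlt j i h hi).symm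

theorem isStarColouring_lexColouring (n : ℕ) : IsStarColouring (lexColouring n) := by
  constructor
  · intro a b x y hab hxy h
    simp only [lexColouring, Sym2.lift_mk] at h
    simp only [Fin.ext_iff]
    omega
  · intro a b d hab hbd had h
    simp only [lexColouring, Sym2.lift_mk] at h
    simp only [ne_eq, Fin.ext_iff] at hab hbd had
    omega

/-- For `t ≥ 2`, `nsar(P_{t-1}) = t`: every star-colouring of `K_t` contains a rainbow
Hamilton path (a rainbow copy of the path on `t` vertices), and `t` is the minimum
integer with this property. -/
theorem nsar_path (t : ℕ) (ht : 2 ≤ t) :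
    (∀ c : EdgeColouring (Fin t), IsStarColouring c →
      HasRainbowCopy c (SimpleGraph.pathGraph t)) ∧
    ∀ m : ℕ, (∀ c : EdgeColouring (Fin m), IsStarColouring c →
      HasRainbowCopy c (SimpleGraph.pathGraph t)) → t ≤ m := by
  refine ⟨fun c hc => ?_, fun m h => ?_⟩
  · obtain ⟨l, hp, hw⟩ := exists_perm_isProperWalk hc.2 (List.finRange t) (List.nodup_finRange t)
    have hl : l.length = t := by simpa using hp.length_eq
    have := hc.hasRainbowCopy_pathGraph (hp.nodup_iff.2 (List.nodup_finRange t)) hw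
    rwa [hl] at this
  · obtain ⟨f, -⟩ := h _ (isStarColouring_lexColouring m)
    simpa using Fintype.card_le_of_embedding f
end

section
/- For all integers n ≥ k ≥ 3, if a star-colouring of the complete graph K_n contains a rainbow cycle C_k, then it contains a rainbow cycle C_t for every integer t with 3 ≤ t ≤ k. -/
open SimpleGraph

theorem cycleGraph_adj_iff_val {k : ℕ} (hk : 3 ≤ k) {u v : Fin k} :
    (cycleGraph k).Adj u v ↔ v.val = u.val + 1 ∨ u.val = v.val + 1 ∨
      v.val = u.val + (k - 1) ∨ u.val = v.val + (k - 1) := by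
  rw [cycleGraph_adj', Fin.val_sub, Fin.val_sub]
  have hu := u.isLt
  have hv := v.isLt
  rcases lt_trichotomy u.val v.val with h | h | h
  · rw [Nat.mod_eq_of_lt (by omega), Nat.mod_eq_sub_mod (by omega), Nat.mod_eq_of_lt (by omega)]
    omega
  · rw [Nat.mod_eq_sub_mod (by omega), Nat.mod_eq_of_lt (by omega),
      Nat.mod_eq_sub_mod (by omega), Nat.mod_eq_of_lt (by omega)]
    omega
  · rw [Nat.mod_eq_sub_mod (by omega), Nat.mod_eq_of_lt (by omega), Nat.mod_eq_of_lt (by omega)]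
    omega

/-- A sequence of `t` distinct vertices whose cyclically consecutive pairs receive distinct
colours spans a rainbow cycle. -/
theorem hasRainbowCopy_cycleGraph_of_seq {α : Type*} {c : EdgeColouring α} {t : ℕ} (ht : 3 ≤ t)
    (g : ℕ → α) (hg : ∀ p q, p < t → q < t → g p = g q → p = q)
    (hpath : ∀ p q, p + 1 < t → q + 1 < t →
      c s(g p, g (p + 1)) = c s(g q, g (q + 1)) → p = q)
    (hclose : ∀ p, p + 1 < t → c s(g (t - 1), g 0) ≠ c s(g p, g (p + 1))) :
    HasRainbowCopy c (cycleGraph t) := by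
  have key : ∀ u v : Fin t, (cycleGraph t).Adj u v → ∃ p, ∃ q,
      s(g u, g v) = s(g p, g q) ∧ (∀ w : Fin t, w ∈ s(u, v) ↔ w.val = p ∨ w.val = q) ∧
      (p + 1 < t ∧ q = p + 1 ∨ p = t - 1 ∧ q = 0) := by
    intro u v h
    have hu := u.isLt
    have hv := v.isLt
    rw [cycleGraph_adj_iff_val ht] at h
    rcases h with h | h | h | h
    · exact ⟨u, v, rfl, by simp [Fin.ext_iff], by omega⟩
    · exact ⟨v, u, Sym2.eq_swap, by simp [Fin.ext_iff, or_comm], by omega⟩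
    · exact ⟨v, u, Sym2.eq_swap, by simp [Fin.ext_iff, or_comm], by omega⟩
    · exact ⟨u, v, rfl, by simp [Fin.ext_iff], by omega⟩
  refine ⟨⟨fun i => g i, fun i j h => Fin.ext (hg _ _ i.isLt j.isLt h)⟩, ?_⟩
  intro u v x y huv hxy hne heq
  obtain ⟨p, q, h1, h2, h3⟩ := key u v huv
  obtain ⟨p', q', h1', h2', h3'⟩ := key x y hxy
  have heq' : c s(g p, g q) = c s(g p', g q') := by
    rw [← h1, ← h1']; exact heq
  have hpp : p = p' ∧ q = q' := by
    rcases h3 with ⟨h3, rfl⟩ | ⟨rfl, rfl⟩ <;> rcases h3' with ⟨h3', rfl⟩ | ⟨rfl, rfl⟩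
    · have := hpath p p' h3 h3' heq'
      omega
    · exact absurd heq'.symm (hclose p h3)
    · exact absurd heq' (hclose p' h3')
    · exact ⟨rfl, rfl⟩
  apply hne
  ext w
  rw [h2, h2', hpp.1, hpp.2]

/-- A rainbow cycle of length `k`, presented as a `k`-periodic sequence indexed by `ℤ`. -/
structure IsRainbowCycle {α : Type*} (c : EdgeColouring α) (k : ℕ) (f : ℤ → α) : Prop where
  periodic : ∀ i, f (i + k) = f i
  inj : ∀ i j, f i = f j → i < j + k → j < i + k → i = j
  colour_inj : ∀ i j, c s(f i, f (i + 1)) = c s(f j, f (j + 1)) → i < j + k → j < i + k → i = j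

theorem exists_isRainbowCycle {α : Type*} {c : EdgeColouring α} {k : ℕ} (hk : 3 ≤ k)
    (h : HasRainbowCopy c (cycleGraph k)) : ∃ f, IsRainbowCycle c k f := by
  obtain ⟨φ, hφ⟩ := h
  have hlt : ∀ i : ℤ, (i % k).toNat < k := fun i => by
    have := Int.emod_lt_of_pos i (b := k) (by omega)
    omega
  let F : ℤ → Fin k := fun i => ⟨(i % k).toNat, hlt i⟩
  have hF : ∀ i j, F i = F j → (k : ℤ) ∣ i - j := by
    intro i j hij
    have h1 := Int.emod_nonneg i (b := k) (by omega)
    have h2 := Int.emod_nonneg j (b := k) (by omega)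
    have h3 : (i % k).toNat = (j % k).toNat := congrArg Fin.val hij
    exact Int.ModEq.dvd (n := k) (a := j) (b := i) (show j % k = i % k by omega)
  have hsmall : ∀ i : ℤ, (k : ℤ) ∣ i → i < k → -k < i → i = 0 := fun i h1 h2 h3 =>
    Int.eq_zero_of_abs_lt_dvd h1 (abs_lt.2 ⟨h3, h2⟩)
  have hadj : ∀ i, (cycleGraph k).Adj (F i) (F (i + 1)) := by
    intro i
    rw [cycleGraph_adj_iff_val hk]
    have h1 := Int.emod_nonneg i (b := k) (by omega)
    have h2 := Int.emod_lt_of_pos i (b := k) (by omega)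
    have h3 : (i + 1) % k = (i % k + 1) % k := by simp
    change ((i + 1) % k).toNat = (i % k).toNat + 1 ∨ (i % k).toNat = ((i + 1) % k).toNat + 1 ∨
      ((i + 1) % k).toNat = (i % k).toNat + (k - 1) ∨
      (i % k).toNat = ((i + 1) % k).toNat + (k - 1)
    rcases eq_or_ne (i % k + 1) k with h4 | h4
    · rw [h4, Int.emod_self] at h3
      omega
    · rw [Int.emod_eq_of_lt (a := i % k + 1) (by omega) (by omega)] at h3
      omega
  refine ⟨fun i => φ (F i), fun i => ?_, fun i j hij h1 h2 => ?_, fun i j hij h1 h2 => ?_⟩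
  · simp [F]
  · have := hsmall _ (hF i j (φ.injective hij)) (by omega) (by omega)
    omega
  · by_contra hne
    refine hφ _ _ _ _ (hadj i) (hadj j) ?_ hij
    intro hs
    rcases Sym2.eq_iff.1 hs with ⟨h3, -⟩ | ⟨h3, h4⟩
    · have := hsmall _ (hF _ _ h3) (by omega) (by omega)
      omega
    · have h5 := dvd_sub (hF _ _ h4) (hF _ _ h3)
      have := hsmall _ h5 (by omega) (by omega)
      omega

theorem edge_congr {α : Type*} (c : EdgeColouring α) (f : ℤ → α) {a b x y : ℤ} (h₁ : a = x)
    (h₂ : b = y) : c s(f a, f b) = c s(f x, f y) := by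
  rw [h₁, h₂]

theorem edge_congr_swap {α : Type*} (c : EdgeColouring α) (f : ℤ → α) {a b x y : ℤ} (h₁ : a = y)
    (h₂ : b = x) : c s(f a, f b) = c s(f x, f y) := by
  rw [h₁, h₂, Sym2.eq_swap]

namespace IsRainbowCycle

variable {α : Type*} {c : EdgeColouring α} {k : ℕ} {f : ℤ → α}

theorem shift (C : IsRainbowCycle c k f) (m : ℤ) : IsRainbowCycle c k (fun i => f (i + m)) where
  periodic i := by
    have := C.periodic (i + m)
    rwa [add_right_comm] at this
  inj i j h h1 h2 := by
    have := C.inj _ _ h (by omega) (by omega)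
    omega
  colour_inj i j h h1 h2 := by
    have := C.colour_inj (i + m) (j + m) (by simpa only [add_right_comm] using h)
      (by omega) (by omega)
    omega

theorem reflect (C : IsRainbowCycle c k f) (m : ℤ) : IsRainbowCycle c k (fun i => f (m - i)) where
  periodic i := by
    rw [← C.periodic (m - (i + k))]
    congr 1
    ring
  inj i j h h1 h2 := by
    have := C.inj _ _ h (by omega) (by omega)
    omega
  colour_inj i j h h1 h2 := by
    have e : ∀ i : ℤ, s(f (m - i), f (m - (i + 1))) = s(f (m - i - 1), f (m - i - 1 + 1)) := by
      intro i
      rw [Sym2.eq_swap, sub_add_cancel, sub_sub]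
    simp only [e] at h
    have := C.colour_inj _ _ h (by omega) (by omega)
    omega

/-- A path on `k - 1` vertices of a rainbow `C_k` whose edges have distinct colours from the
cycle: if there is no rainbow `C_{k-1}`, then the edge closing the path repeats one of them. -/
theorem exists_colour_eq_closing (C : IsRainbowCycle c k f) (hk : 4 ≤ k)
    (hN : ¬ HasRainbowCopy c (cycleGraph (k - 1))) (v o : ℕ → ℤ)
    (hv : ∀ p, p + 1 < k → 0 ≤ v p ∧ v p < k)
    (hvi : ∀ p q, p + 1 < k → q + 1 < k → v p = v q → p = q)
    (ho : ∀ p, p + 2 < k → 0 ≤ o p ∧ o p < k)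
    (hoi : ∀ p q, p + 2 < k → q + 2 < k → o p = o q → p = q)
    (hcol : ∀ p, p + 2 < k → c s(f (v p), f (v (p + 1))) = c s(f (o p), f (o p + 1))) :
    ∃ p, p + 2 < k ∧ c s(f (v (k - 2)), f (v 0)) = c s(f (o p), f (o p + 1)) := by
  by_contra! hcon
  apply hN
  refine hasRainbowCopy_cycleGraph_of_seq (by omega) (fun p => f (v p)) ?_ ?_ ?_
  · intro p q hp hq h
    have := hv p (by omega)
    have := hv q (by omega)
    exact hvi p q (by omega) (by omega) (C.inj _ _ h (by omega) (by omega))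
  · intro p q hp hq h
    have := ho p (by omega)
    have := ho q (by omega)
    rw [hcol p (by omega), hcol q (by omega)] at h
    exact hoi p q (by omega) (by omega) (C.colour_inj _ _ h (by omega) (by omega))
  · intro p hp
    rw [hcol p (by omega), show k - 1 - 1 = k - 2 by omega]
    exact hcon p (by omega)

/-- If there is no rainbow `C_{k-1}`, every chord of length two takes the colour of one of the
two cycle edges continuing it. -/
theorem colour_short_chord_zero (C : IsRainbowCycle c k f) (hc : IsStarColouring c) (hk : 4 ≤ k)
    (hN : ¬ HasRainbowCopy c (cycleGraph (k - 1))) :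
    c s(f 0, f 2) = c s(f 2, f 3) ∨ c s(f 0, f 2) = c s(f (-1), f 0) := by
  have hk0 : f k = f 0 := by simpa using C.periodic 0
  have hk1 : f (k - 1) = f (-1) := by
    rw [← C.periodic (-1), neg_add_eq_sub]
  obtain ⟨p, hp, h⟩ := C.exists_colour_eq_closing hk hN
    (fun p => if p + 2 = k then 0 else p + 2) (fun p => p + 2)
    (by intro p hp; split_ifs <;> omega) (by intro p q hp hq; split_ifs <;> omega)
    (by intro p hp; omega) (by intro p q hp hq; omega)
    (by
      intro p hp
      simp only [if_neg (show p + 2 ≠ k by omega)]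
      split_ifs with h
      · rw [← hk0]
        exact edge_congr c f (by omega) (by omega)
      · exact edge_congr c f (by omega) (by omega))
  have e1 : k - 2 + 2 = k := by omega
  have e2 : 0 + 2 ≠ k := by omega
  simp only [e1, if_true, e2, if_false] at h
  norm_num at h
  have h02 : f 0 ≠ f 2 := fun h' => by have := C.inj _ _ h' (by omega) (by omega); omega
  have hpp : f (p + 2) ≠ f (p + 2 + 1) := fun h' => by
    have := C.inj _ _ h' (by omega) (by omega); omega
  have hor : (p : ℤ) = 0 ∨ (p : ℤ) + 3 = k := by
    rcases hc.1 _ _ _ _ h02 hpp h with h' | h' | h' | h'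
    · have := C.inj _ _ h' (by omega) (by omega); omega
    · by_cases hpk : (p : ℤ) + 3 = k
      · exact Or.inr hpk
      · have := C.inj _ _ h' (by omega) (by omega); omega
    · have := C.inj _ _ h' (by omega) (by omega); omega
    · have := C.inj _ _ h' (by omega) (by omega); omega
  rcases hor with h' | h'
  · left
    rw [h, h']; norm_num
  · right
    rw [h, show (p : ℤ) + 2 = k - 1 by omega, hk1, sub_add_cancel, hk0]

theorem eq_or_eq_of_colour_eq (C : IsRainbowCycle c k f) (hc : IsStarColouring c) (hk : 3 ≤ k)
    {a b q : ℤ} (hab : a ≠ b) (ha : 0 ≤ a ∧ a < k) (hb : 0 ≤ b ∧ b < k) (hq : 0 ≤ q ∧ q < k)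
    (h : c s(f a, f b) = c s(f q, f (q + 1))) :
    q = a ∨ q = b ∨ q + 1 = a ∨ q + 1 = b ∨ q = k - 1 := by
  by_contra! hne
  have hab' : f a ≠ f b := fun h' => by have := C.inj _ _ h' (by omega) (by omega); omega
  have hqq : f q ≠ f (q + 1) := fun h' => by have := C.inj _ _ h' (by omega) (by omega); omega
  rcases hc.1 _ _ _ _ hab' hqq h with h' | h' | h' | h' <;>
    (have := C.inj _ _ h' (by omega) (by omega); omega)

/-- If there is no rainbow `C_{k-1}`, a chord takes the colour of the cycle edge leaving one of its
endpoints, provided that the preceding shorter chord does. -/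
theorem colour_chord_zero (C : IsRainbowCycle c k f) (hc : IsStarColouring c)
    (hN : ¬ HasRainbowCopy c (cycleGraph (k - 1))) (j : ℕ) (hj : 3 ≤ j) (hjk : j + 2 ≤ k)
    (hprev : c s(f (-1), f (j - 2)) = c s(f (-1), f 0) ∨
      c s(f (-1), f (j - 2)) = c s(f (j - 2), f (j - 1))) :
    c s(f 0, f j) = c s(f 0, f 1) ∨ c s(f 0, f j) = c s(f j, f (j + 1)) := by
  have hk0 : f k = f 0 := by simpa using C.periodic 0
  have hk1 : f (k - 1) = f (-1) := by
    rw [← C.periodic (-1), neg_add_eq_sub]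
  obtain ⟨w, hw, hwc⟩ : ∃ w : ℤ, (w = k - 1 ∨ w = j - 2) ∧
      c s(f (k - 1), f (j - 2)) = c s(f w, f (w + 1)) := by
    rcases hprev with h | h
    · exact ⟨k - 1, Or.inl rfl, by rw [sub_add_cancel, hk1, hk0, h]⟩
    · exact ⟨j - 2, Or.inr rfl, by rw [hk1, h]; exact edge_congr c f rfl (by ring)⟩
  obtain ⟨p, hp, h⟩ := C.exists_colour_eq_closing (by omega) hN
    (fun p => if p + j < k then j + p else k - 2 - p)
    (fun p => if p + j + 1 < k then j + p else if p + j + 1 = k then w else k - 3 - p)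
    (by intro p hp; split_ifs <;> omega)
    (by intro p q hp hq; split_ifs <;> omega)
    (by intro p hp; split_ifs <;> omega)
    (by intro p q hp hq; split_ifs <;> omega)
    (by
      intro p hp
      rcases lt_trichotomy (p + j + 1) k with h | h | h
      · rw [if_pos (by omega), if_pos (by omega), if_pos (by omega)]
        exact edge_congr c f rfl (by omega)
      · rw [if_pos (by omega), if_neg (by omega), if_neg (by omega), if_pos (by omega), ← hwc]
        exact edge_congr c f (by omega) (by omega)
      · rw [if_neg (by omega), if_neg (by omega), if_neg (by omega), if_neg (by omega)]
        exact edge_congr_swap c f (by omega) (by omega))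
  generalize ho : (if p + j + 1 < k then (j + p : ℤ) else if p + j + 1 = k then w else k - 3 - p)
    = o at h
  rw [if_neg (by omega), if_pos (by omega)] at h
  have h0j : c s(f 0, f j) = c s(f o, f (o + 1)) := by
    rw [← h]
    exact edge_congr c f (by omega) (by simp)
  have hor : (o = k - 1 ∧ w = k - 1) ∨ o = 0 ∨ o = j := by
    have := C.eq_or_eq_of_colour_eq hc (by omega) (by omega) (by omega) (by omega)
      (by split_ifs at ho <;> omega) h0j
    split_ifs at ho <;> omega
  rcases hor with ⟨h1, h2⟩ | h1 | h1
  · rw [h1, ← h2, ← hwc, hk1] at h0j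
    rcases hc.1 _ _ _ _
      (fun h' => by have := C.inj _ _ h' (by omega) (by omega); omega)
      (fun h' => by have := C.inj _ _ h' (by omega) (by omega); omega) h0j with h' | h' | h' | h' <;>
    (have := C.inj _ _ h' (by omega) (by omega); omega)
  · left
    rw [h0j, h1, zero_add]
  · right
    rw [h0j, h1]

/-- The short chords of a rainbow `C_k` cannot point in both directions. -/
theorem false_of_mixed_chords (C : IsRainbowCycle c k f) (hc : IsStarColouring c) (hk : 6 ≤ k)
    (hN : ¬ HasRainbowCopy c (cycleGraph (k - 1)))
    (h13 : c s(f 1, f 3) = c s(f 0, f 1)) (h₁ : c s(f (-1), f 1) = c s(f 1, f 2))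
    (h46 : c s(f 4, f 6) = c s(f 3, f 4)) : False := by
  have hk1 : f (k - 1) = f (-1) := by
    rw [← C.periodic (-1), neg_add_eq_sub]
  have ne : ∀ a b : ℤ, a ≠ b → a < b + k → b < a + k → f a ≠ f b := fun a b hab h1 h2 h =>
    hab (C.inj a b h h1 h2)
  obtain ⟨p, hp, h⟩ := C.exists_colour_eq_closing (by omega) hN
    (fun p => if p = 0 then 0 else if p = 1 then 1 else k + 1 - p)
    (fun p => if p = 0 then 0 else if p = 1 then 1 else k - p)
    (by intro p hp; split_ifs <;> omega)
    (by intro p q hp hq; split_ifs <;> omega)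
    (by intro p hp; split_ifs <;> omega)
    (by intro p q hp hq; split_ifs <;> omega)
    (by
      intro p hp
      rcases p with _ | _ | p
      · simp
      · norm_num
        rw [show (k : ℤ) + 1 - 2 = k - 1 by ring, hk1, Sym2.eq_swap, h₁]
      · simp only [Nat.add_eq_zero_iff, one_ne_zero, and_false, if_false,
          show p + 1 + 1 ≠ 1 by omega, show p + 1 + 1 + 1 ≠ 1 by omega]
        exact edge_congr_swap c f (by push_cast; ring) (by push_cast; ring))
  generalize ho : (if p = 0 then (0 : ℤ) else if p = 1 then 1 else k - p) = o at h
  rw [if_neg (by omega), if_neg (by omega), if_pos rfl] at h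
  have h30 : c s(f 3, f 0) = c s(f o, f (o + 1)) := by
    rw [← h]
    exact edge_congr c f (by omega) rfl
  have hor : o = 0 ∨ o = 3 := by
    have := C.eq_or_eq_of_colour_eq hc (by omega) (by omega) (by omega) (by omega)
      (by split_ifs at ho <;> omega) h30
    split_ifs at ho <;> omega
  rcases hor with rfl | rfl
  · refine hc.2 (f 0) (f 1) (f 3) (ne _ _ ?_ ?_ ?_) (ne _ _ ?_ ?_ ?_) (ne _ _ ?_ ?_ ?_)
      ⟨h13.symm, ?_⟩
    any_goals omega
    rw [h13, Sym2.eq_swap (a := f 0) (b := f 3), h30, zero_add]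
  · norm_num at h30
    rw [← h46] at h30
    rcases hc.1 _ _ _ _ (ne _ _ (by omega) (by omega) (by omega))
      (ne _ _ (by omega) (by omega) (by omega)) h30 with h' | h' | h' | h'
    · exact ne _ _ (by omega) (by omega) (by omega) h'
    · exact ne _ _ (by omega) (by omega) (by omega) h'
    · exact ne _ _ (by omega) (by omega) (by omega) h'
    · refine hc.2 (f 0) (f 3) (f 4) (ne _ _ ?_ ?_ ?_) (ne _ _ ?_ ?_ ?_) (ne _ _ ?_ ?_ ?_)
        ⟨?_, ?_⟩
      any_goals omega
      · rw [Sym2.eq_swap, h30, h46]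
      · rw [← h46, h', Sym2.eq_swap]

end IsRainbowCycle

/-- A tournament on `0, …, K - 1` containing all arcs `x → x + 1` and `x + 2 → x` has directed
cycles spanning each initial segment with at least three vertices. -/
theorem exists_directed_cycle_of_tournament {K : ℕ} (D : ℕ → ℕ → Prop)
    (htot : ∀ x y, x < y → y < K → D x y ∨ D y x)
    (hasymm : ∀ x y, x < y → y < K → ¬ (D x y ∧ D y x))
    (hsucc : ∀ x, x + 1 < K → D x (x + 1)) (hback : ∀ x, x + 2 < K → D (x + 2) x)
    (m : ℕ) (hm : 3 ≤ m) (hmK : m ≤ K) :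
    ∃ v : ℕ → ℕ, (∀ p, p < m → v p < m) ∧ (∀ p q, p < m → q < m → v p = v q → p = q) ∧
      (∀ x, x < m → ∃ p, p < m ∧ v p = x) ∧ (∀ p, p + 1 < m → D (v p) (v (p + 1))) ∧
      D (v (m - 1)) (v 0) := by
  induction m, hm using Nat.le_induction with
  | base =>
    exact ⟨id, fun p hp => hp, fun p q _ _ h => h, fun x hx => ⟨x, hx, rfl⟩,
      fun p hp => hsucc p (by omega), hback 0 (by omega)⟩
  | succ m hm ih =>
    obtain ⟨v, hv, hvi, hvs, hvp, hvc⟩ := ih (by omega)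
    have hins : ∃ p, p < m ∧ D (v p) m ∧
        (p + 1 < m ∧ D m (v (p + 1)) ∨ p + 1 = m ∧ D m (v 0)) := by
      by_contra! hcon
      have hstep : ∀ p, p + 1 < m → D (v p) m → D (v (p + 1)) m := fun p hp h =>
        (htot _ _ (hv _ hp) (by omega)).resolve_right ((hcon p (by omega) h).1 hp)
      have hmono : ∀ p q, p ≤ q → q < m → D (v p) m → D (v q) m := by
        intro p q hpq
        induction q, hpq using Nat.le_induction with
        | base => exact fun _ h => h
        | succ q hq ih => exact fun h1 h2 => hstep q h1 (ih (by omega) h2)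
      obtain ⟨a, ha, hav⟩ := hvs (m - 1) (by omega)
      obtain ⟨b, hb, hbv⟩ := hvs (m - 2) (by omega)
      have h1 : D (v a) m := by
        have := hsucc (m - 1) (by omega)
        rwa [hav, ← Nat.sub_add_cancel (show 1 ≤ m by omega)]
      have h2 : D (v (m - 1)) m := hmono a _ (by omega) (by omega) h1
      have h3 : D (v 0) m := (htot _ _ (hv 0 (by omega)) (by omega)).resolve_right
        ((hcon (m - 1) (by omega) h2).2 (by omega))
      have h4 : D (v b) m := hmono 0 b (by omega) hb h3
      have h5 : D m (v b) := by
        have := hback (m - 2) (by omega)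
        rwa [Nat.sub_add_cancel (show 2 ≤ m by omega), ← hbv] at this
      exact hasymm _ _ (hv b hb) (by omega) ⟨h4, h5⟩
    obtain ⟨r, hr, hrm, hmr⟩ := hins
    refine ⟨fun p => if p ≤ r then v p else if p = r + 1 then m else v (p - 1),
      ?_, ?_, ?_, ?_, ?_⟩
    · intro p hp
      dsimp only
      split_ifs
      · have := hv p (by omega)
        omega
      · omega
      · have := hv (p - 1) (by omega)
        omega
    · intro p q hp hq
      dsimp only
      have hlt := fun p (hp : p < m) => (hv p hp).ne
      split_ifs with h1 h2 h3 h4 h5 h6 h7 h8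
      · exact hvi _ _ (by omega) (by omega)
      · exact fun h => absurd h (hlt _ (by omega))
      · intro h
        have := hvi _ _ (by omega) (by omega) h
        omega
      · exact fun h => absurd h.symm (hlt _ (by omega))
      · omega
      · exact fun h => absurd h.symm (hlt _ (by omega))
      · intro h
        have := hvi _ _ (by omega) (by omega) h
        omega
      · exact fun h => absurd h (hlt _ (by omega))
      · intro h
        have := hvi _ _ (by omega) (by omega) h
        omega
    · intro x hx
      rcases eq_or_ne x m with rfl | hxm
      · exact ⟨r + 1, by omega, by simp⟩
      · obtain ⟨p, hp, rfl⟩ := hvs x (by omega)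
        rcases le_or_gt p r with h | h
        · exact ⟨p, by omega, if_pos h⟩
        · exact ⟨p + 1, by omega, by simp [show ¬ p + 1 ≤ r by omega, show p ≠ r by omega]⟩
    · intro p hp
      dsimp only
      rcases lt_trichotomy p r with h | rfl | h
      · rw [if_pos (by omega), if_pos (by omega)]
        exact hvp p (by omega)
      · rw [if_pos le_rfl, if_neg (by omega), if_pos rfl]
        exact hrm
      · rcases eq_or_ne p (r + 1) with rfl | h'
        · rw [if_neg (by omega), if_pos rfl, if_neg (by omega), if_neg (by omega)]
          exact (hmr.resolve_right (by omega)).2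
        · rw [if_neg (by omega), if_neg h', if_neg (by omega), if_neg (by omega)]
          have := hvp (p - 1) (by omega)
          rwa [Nat.sub_add_cancel (by omega)] at this
    · dsimp only
      rw [if_neg (by omega), if_pos (Nat.zero_le r), Nat.add_sub_cancel]
      split_ifs with h
      · exact (hmr.resolve_left (by omega)).2
      · exact hvc

namespace IsRainbowCycle

variable {α : Type*} {c : EdgeColouring α} {k : ℕ} {f : ℤ → α}

/-- If the short chords of a rainbow `C_k` all point backwards along the cycle, then there is a
rainbow `C_{k-1}`. -/
theorem hasRainbowCopy_pred_of_forall (C : IsRainbowCycle c k f) (hc : IsStarColouring c)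
    (hk : 4 ≤ k) (hF : ∀ i, c s(f i, f (i + 2)) = c s(f (i + 2), f (i + 3))) :
    HasRainbowCopy c (cycleGraph (k - 1)) := by
  by_contra hN
  have hown : ∀ j : ℕ, 1 ≤ j → j + 2 ≤ k → ∀ i : ℤ, c s(f i, f (i + j)) = c s(f i, f (i + 1)) ∨
      c s(f i, f (i + j)) = c s(f (i + j), f (i + j + 1)) := by
    intro j hj
    induction j, hj using Nat.le_induction with
    | base => exact fun _ i => Or.inl (by simp)
    | succ j hj ih =>
      intro hjk i
      rcases eq_or_ne j 1 with rfl | hj1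
      · right
        norm_num
        rw [hF i]
        exact edge_congr c f rfl (by ring)
      · have h := ih (by omega) (i - 1)
        rw [show i - 1 + j + 1 = ((j + 1 : ℕ) : ℤ) - 1 + i by push_cast; ring,
          show i - 1 + 1 = 0 + i by ring,
          show i - 1 + j = ((j + 1 : ℕ) : ℤ) - 2 + i by push_cast; ring,
          show i - 1 = -1 + i by ring] at h
        have h' := (C.shift i).colour_chord_zero hc hN (j + 1) (by omega) hjk h
        simp only [zero_add] at h'
        rwa [add_comm i, add_comm i, add_right_comm]
  obtain ⟨v, hv, hvi, -, hvp, hvc⟩ := exists_directed_cycle_of_tournament (K := k - 1)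
    (fun x y => c s(f x, f y) = c s(f x, f (x + 1)))
    (by
      intro x y hxy hy
      have h := hown (y - x) (by omega) (by omega) x
      rw [show (x : ℤ) + (y - x : ℕ) = y by omega] at h
      rwa [Sym2.eq_swap (a := f y) (b := f x)])
    (by
      rintro x y hxy hy ⟨h1, h2⟩
      rw [Sym2.eq_swap, h1] at h2
      have := C.colour_inj _ _ h2 (by omega) (by omega)
      omega)
    (by intro x hx; push_cast; rfl)
    (by
      intro x hx
      push_cast
      rw [Sym2.eq_swap, hF]
      exact edge_congr c f rfl (by ring))
    (k - 1) (by omega) le_rfl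
  refine hN (hasRainbowCopy_cycleGraph_of_seq (by omega) (fun p => f (v p)) ?_ ?_ ?_)
  · intro p q hp hq h
    have h1 := hv p hp
    have h2 := hv q hq
    have := C.inj _ _ h (by omega) (by omega)
    exact hvi p q hp hq (by omega)
  · intro p q hp hq h
    have h1 := hv p (by omega)
    have h2 := hv q (by omega)
    rw [hvp p hp, hvp q hq] at h
    have := C.colour_inj _ _ h (by omega) (by omega)
    exact hvi p q (by omega) (by omega) (by omega)
  · intro p hp h
    have h1 := hv p (by omega)
    have h2 := hv (k - 1 - 1) (by omega)
    rw [hvp p hp, hvc] at h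
    have := C.colour_inj _ _ h (by omega) (by omega)
    have := hvi p (k - 1 - 1) (by omega) (by omega) (by omega)
    omega

theorem colour_short_chord (C : IsRainbowCycle c k f) (hc : IsStarColouring c) (hk : 4 ≤ k)
    (hN : ¬ HasRainbowCopy c (cycleGraph (k - 1))) (i : ℤ) :
    c s(f i, f (i + 2)) = c s(f (i + 2), f (i + 3)) ∨ c s(f i, f (i + 2)) = c s(f (i - 1), f i) := by
  have h := (C.shift i).colour_short_chord_zero hc hk hN
  rw [zero_add, neg_add_eq_sub] at h
  rwa [add_comm i, add_comm i]

theorem hasRainbowCopy_pred (C : IsRainbowCycle c k f) (hc : IsStarColouring c) (hk : 4 ≤ k) :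
    HasRainbowCopy c (cycleGraph (k - 1)) := by
  by_contra hN
  have hFB := C.colour_short_chord hc hk hN
  have ne : ∀ a b : ℤ, a ≠ b → a < b + k → b < a + k → f a ≠ f b := fun a b hab h1 h2 h =>
    hab (C.inj a b h h1 h2)
  rcases hk.eq_or_lt with rfl | hk
  · have e4 : f 4 = f 0 := C.periodic 0
    have e5 : f 5 = f 1 := C.periodic 1
    have e3 : f (-1) = f 3 := (C.periodic (-1)).symm
    have h0 := hFB 0
    have h2 := hFB 2
    norm_num [e3, e4, e5] at h0 h2
    rw [Sym2.eq_swap (a := f 2) (b := f 0)] at h2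
    rcases h0 with h0 | h0 <;> rcases h2 with h2 | h2 <;> rw [h0] at h2
    · exact absurd (C.colour_inj 2 0 h2 (by norm_num) (by norm_num)) (by norm_num)
    · exact absurd (C.colour_inj 2 1 h2 (by norm_num) (by norm_num)) (by norm_num)
    · rw [← e4] at h2
      nth_rewrite 2 [e4] at h2
      exact absurd (C.colour_inj 3 0 h2 (by norm_num) (by norm_num)) (by norm_num)
    · rw [← e4] at h2
      exact absurd (C.colour_inj 3 1 h2 (by norm_num) (by norm_num)) (by norm_num)
  let F : ℤ → Prop := fun i => c s(f i, f (i + 2)) = c s(f (i + 2), f (i + 3))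
  let B : ℤ → Prop := fun i => c s(f i, f (i + 2)) = c s(f (i - 1), f i)
  have hFB' : ∀ i, F i ∨ B i := hFB
  have hexcl : ∀ i, F i → B i → False := by
    intro i h1 h2
    have h3 : c s(f (i + 2), f (i + 2 + 1)) = c s(f (i - 1), f (i - 1 + 1)) := by
      rw [sub_add_cancel, ← h2, h1]
      exact edge_congr c f rfl (by ring)
    have := C.colour_inj _ _ h3 (by omega) (by omega)
    omega
  have hF3 : ∀ i, F i → F (i + 3) := by
    intro i h
    refine (hFB' (i + 3)).resolve_right fun h' => ?_
    have h1 : c s(f i, f (i + 2)) = c s(f (i + 3), f (i + 5)) := by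
      change c _ = c _ at h h'
      rw [h, edge_congr c f rfl (show i + 5 = i + 3 + 2 by ring), h']
      exact edge_congr c f (by ring) rfl
    rcases hc.1 _ _ _ _ (ne _ _ (by omega) (by omega) (by omega))
      (ne _ _ (by omega) (by omega) (by omega)) h1 with h2 | h2 | h2 | h2
    · exact ne _ _ (by omega) (by omega) (by omega) h2
    · refine hc.2 (f i) (f (i + 2)) (f (i + 3)) (ne _ _ ?_ ?_ ?_) (ne _ _ ?_ ?_ ?_)
        (ne _ _ ?_ ?_ ?_) ⟨h, ?_⟩
      any_goals omega
      rw [← show c _ = c _ from h, h1, ← h2, Sym2.eq_swap]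
    · exact ne _ _ (by omega) (by omega) (by omega) h2
    · exact ne _ _ (by omega) (by omega) (by omega) h2
  have hmul : ∀ d : ℤ, (∀ i, F i → F (i + d)) → ∀ n : ℕ, ∀ i, F i → F (i + n * d) := by
    intro d hd n
    induction n with
    | zero => intro i h; simpa using h
    | succ n ih =>
      intro i h
      have := hd _ (ih i h)
      rwa [show i + n * d + d = i + (n + 1 : ℕ) * d by push_cast; ring] at this
  have hFk' : ∀ i, F (i + k) → F i := by
    intro i h
    change c _ = c _ at h
    rw [add_right_comm i k 2, add_right_comm i k 3, C.periodic, C.periodic, C.periodic] at h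
    exact h
  have hF3' : ∀ i, F i → F (i - 3) := by
    intro i h
    have h1 := hmul 3 hF3 (k - 1) i h
    refine hFk' _ (hFk' _ (hFk' _ ?_))
    rwa [show i - 3 + k + k + k = i + (k - 1 : ℕ) * 3 by omega]
  have hB3 : ∀ i, B i → B (i + 3) := fun i h => (hFB' (i + 3)).resolve_left fun h' => by
    have := hF3' _ h'
    rw [add_sub_cancel_right] at this
    exact hexcl _ this h
  by_cases hall : ∀ i, F i
  · exact hN (C.hasRainbowCopy_pred_of_forall hc hk.le hall)
  by_cases hnone : ∀ i, B i
  · refine hN ((C.reflect 0).hasRainbowCopy_pred_of_forall hc hk.le fun i => ?_)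
    have h := hnone (-i - 2)
    change c _ = c _ at h
    rw [Sym2.eq_swap (a := f (-i - 2 - 1)), Sym2.eq_swap (a := f (-i - 2))] at h
    rw [edge_congr c f (show 0 - i = -i - 2 + 2 by ring) (show 0 - (i + 2) = -i - 2 by ring), h]
    exact edge_congr c f (by ring) (by ring)
  obtain ⟨m, hm, hm1⟩ : ∃ m, F m ∧ B (m + 1) := by
    by_contra! hcon
    push Not at hall hnone
    obtain ⟨a, ha⟩ := hall
    obtain ⟨b, hb⟩ := hnone
    have hb' : F b := (hFB' b).resolve_right hb
    have h1 := hmul 1 (fun i h => (hFB' (i + 1)).resolve_right (hcon i h))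
    have hdown := hmul (-k) (fun i h => hFk' _ (by simpa using h))
    have h2 := hdown (b - a).toNat b hb'
    have hle : b + ((b - a).toNat : ℤ) * (-k) ≤ a := by
      have : (0 : ℤ) ≤ (b - a).toNat := by omega
      nlinarith [Int.self_le_toNat (b - a)]
    have h3 := h1 (a - (b + ((b - a).toNat : ℤ) * (-k))).toNat _ h2
    rw [Int.toNat_of_nonneg (sub_nonneg.2 hle)] at h3
    exact ha (by simpa using h3)
  rcases (show 5 ≤ k from hk).eq_or_lt with rfl | hk
  · have h := hF3 _ (hF3 _ hm)
    exact hexcl _ (hFk' (m + 1) (by convert h using 1; push_cast; ring)) hm1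
  · rcases hFB' (m - 1) with h | h
    · have h4 := hB3 _ hm1
      change c _ = c _ at h hm1 h4
      refine (C.shift m).false_of_mixed_chords hc hk hN ?_ ?_ ?_
      · rw [edge_congr c f (show 1 + m = m + 1 by ring) (show 3 + m = m + 1 + 2 by ring), hm1]
        exact edge_congr c f (by ring) (by ring)
      · rw [edge_congr c f (show -1 + m = m - 1 by ring) (show 1 + m = m - 1 + 2 by ring), h]
        exact edge_congr c f (by ring) (by ring)
      · rw [edge_congr c f (show 4 + m = m + 1 + 3 by ring) (show 6 + m = m + 1 + 3 + 2 by ring),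
          h4]
        exact edge_congr c f (by ring) (by ring)
    · have h2 := hB3 _ h
      have h3 := hF3' _ hm
      change c _ = c _ at hm h2 h3
      refine (C.reflect (m + 3)).false_of_mixed_chords hc hk hN ?_ ?_ ?_
      · rw [edge_congr_swap c f (show m + 3 - 1 = m + 2 by ring) (show m + 3 - 3 = m by ring), hm]
        exact edge_congr_swap c f (by ring) (by ring)
      · rw [edge_congr_swap c f (show m + 3 - -1 = m - 1 + 3 + 2 by ring)
          (show m + 3 - 1 = m - 1 + 3 by ring), h2]
        exact edge_congr_swap c f (by ring) (by ring)
      · rw [edge_congr_swap c f (show m + 3 - 4 = m - 3 + 2 by ring)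
          (show m + 3 - 6 = m - 3 by ring), h3]
        exact edge_congr_swap c f (by ring) (by ring)

end IsRainbowCycle

/-- For `n ≥ k ≥ 3`, if a star-colouring of `K_n` has a rainbow `C_k`, then it has a
rainbow `C_t` for all `3 ≤ t ≤ k`. -/
theorem rainbow_cycle_all_lengths (n k : ℕ) (hk : 3 ≤ k) (hkn : k ≤ n)
    (c : EdgeColouring (Fin n)) (hc : IsStarColouring c)
    (h : HasRainbowCopy c (SimpleGraph.cycleGraph k)) :
    ∀ t : ℕ, 3 ≤ t → t ≤ k → HasRainbowCopy c (SimpleGraph.cycleGraph t) := by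
  intro t ht htk
  induction htk using Nat.decreasingInduction with
  | self => exact h
  | of_succ t htk ih =>
    obtain ⟨f, hf⟩ := exists_isRainbowCycle (by omega) (ih (by omega))
    exact hf.hasRainbowCopy_pred hc (by omega)
end

section
/- Let n ≥ 4 be an integer, let G be a star-colouring of K_n and let v be a vertex of K_n. If v is a centre of at least two colour classes (stars) and the restriction of the colouring to K_n - v contains a rainbow Hamilton cycle C_{n-1}, then G contains a rainbow Hamilton cycle C_n. -/
open SimpleGraph

/-- A property closed under cyclic successor that holds somewhere on `Fin (k + 1)` holds
everywhere. -/
theorem Fin.forall_of_add_one {k : ℕ} {P : Fin (k + 1) → Prop} (hstep : ∀ i, P i → P (i + 1))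
    {p : Fin (k + 1)} (hp : P p) (q : Fin (k + 1)) : P q := by
  have h : ∀ j : ℕ, P (p + Fin.ofNat (k + 1) j) := by
    intro j
    induction j with
    | zero => simpa using hp
    | succ j ih =>
      have hj : Fin.ofNat (k + 1) (j + 1) = Fin.ofNat (k + 1) j + 1 := by
        simp [Fin.ext_iff, Fin.val_add]
      rw [hj, ← add_assoc]
      exact hstep _ ih
  simpa using h (q - p).val

/-- A map of a cycle is rainbow if consecutive pairs receive pairwise distinct colours. -/
theorem rainbow_cycleGraph_of_injective {α : Type*} {k : ℕ} (c : EdgeColouring α)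
    (f : Fin (k + 2) → α) (h : Function.Injective fun i => c s(f i, f (i + 1)))
    (u v x y : Fin (k + 2)) (huv : (cycleGraph (k + 2)).Adj u v)
    (hxy : (cycleGraph (k + 2)).Adj x y) (hne : s(u, v) ≠ s(x, y)) :
    c s(f u, f v) ≠ c s(f x, f y) := by
  have key : ∀ a b : Fin (k + 2), (cycleGraph (k + 2)).Adj a b →
      ∃ i, s(a, b) = s(i, i + 1) := by
    intro a b hab
    rw [cycleGraph_adj] at hab
    rcases hab with hab | hab
    · exact ⟨b, by rw [sub_eq_iff_eq_add.1 hab, add_comm 1 b, Sym2.eq_swap]⟩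
    · exact ⟨a, by rw [sub_eq_iff_eq_add'.1 hab]⟩
  obtain ⟨i, hi⟩ := key u v huv
  obtain ⟨j, hj⟩ := key x y hxy
  have hf : ∀ {a b i : Fin (k + 2)}, s(a, b) = s(i, i + 1) → s(f a, f b) = s(f i, f (i + 1)) :=
    fun h => by simpa using congrArg (Sym2.map f) h
  rw [hf hi, hf hj]
  intro hc
  have hij : i = j := h hc
  exact hne (by rw [hi, hj, hij])

/-- Consecutive pairs of a rainbow cycle of length at least three receive pairwise distinct
colours. -/
theorem injective_of_rainbow_cycleGraph {α : Type*} {k : ℕ} (c : EdgeColouring α)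
    (f : Fin (k + 3) → α)
    (h : ∀ u v x y : Fin (k + 3), (cycleGraph (k + 3)).Adj u v → (cycleGraph (k + 3)).Adj x y →
      s(u, v) ≠ s(x, y) → c s(f u, f v) ≠ c s(f x, f y)) :
    Function.Injective fun i => c s(f i, f (i + 1)) := by
  have adj : ∀ i : Fin (k + 3), (cycleGraph (k + 3)).Adj i (i + 1) := fun i => by
    rw [cycleGraph_adj]; right; simp
  intro i j hij
  by_contra hne
  refine h _ _ _ _ (adj i) (adj j) ?_ hij
  rw [Ne, Sym2.eq_iff]
  rintro (⟨h1, -⟩ | ⟨h1, h2⟩)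
  · exact hne h1
  · rw [h1, add_assoc, add_eq_left, Fin.ext_iff, Fin.val_add, Fin.val_one] at h2
    rw [Nat.mod_eq_of_lt (by omega)] at h2
    simp at h2

/-- Inserting a vertex `v` between two consecutive vertices of a rainbow cycle of a
star-colouring yields a rainbow cycle unless one of three local coincidences occurs. -/
theorem IsStarColouring.hasRainbowCopy_of_insert {α : Type*} {k : ℕ} {c : EdgeColouring α}
    (hc : IsStarColouring c) {v : α} (f : Fin (k + 3) ↪ α) (hfv : ∀ i, f i ≠ v)
    (hf : Function.Injective fun i => c s(f i, f (i + 1))) (i : Fin (k + 3))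
    (h : c s(v, f (i + 1)) ≠ c s(v, f (i + 1 + 1)))
    (hl : c s(v, f (i + 1)) ≠ c s(f i, f (i + 1)))
    (hr : c s(v, f (i + 1 + 1)) ≠ c s(f (i + 1 + 1), f (i + 1 + 1 + 1))) :
    HasRainbowCopy c (cycleGraph (k + 4)) := by
  have succ_ne : ∀ j : Fin (k + 3), f j ≠ f (j + 1) := fun j hj => by
    simpa using f.injective hj
  have touch : ∀ {p j : Fin (k + 3)}, c s(v, f p) = c s(f j, f (j + 1)) → p = j ∨ p = j + 1 := by
    intro p j hpj
    rcases hc.1 _ _ _ _ (hfv p).symm (succ_ne j) hpj with h | h | h | h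
    · exact (hfv _ h.symm).elim
    · exact (hfv _ h.symm).elim
    · exact Or.inl (f.injective h)
    · exact Or.inr (f.injective h)
  let g : Fin (k + 4) → α := Fin.cons v fun j : Fin (k + 3) => f (i + 1 + 1 + j)
  have hg : Function.Injective g := by
    rw [Fin.cons_injective_iff]
    refine ⟨?_, fun a b hab => add_left_cancel (f.injective hab)⟩
    rintro ⟨j, hj⟩
    exact hfv _ hj
  have hcol : (fun j => c s(g j, g (j + 1))) =
      Fin.cons (c s(v, f (i + 1 + 1))) (Fin.snoc (α := fun _ => ℕ)
        (fun j : Fin (k + 2) => c s(f (i + 1 + 1 + j.castSucc), f (i + 1 + 1 + j.castSucc + 1)))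
        (c s(v, f (i + 1)))) := by
    funext j
    refine Fin.cases ?_ (fun j => ?_) j
    · have : (0 : Fin (k + 4)) + 1 = Fin.succ 0 := by simp
      rw [this]
      simp [g]
    · refine Fin.lastCases ?_ (fun j => ?_) j
      · have h0 : (Fin.last (k + 2)).succ + 1 = (0 : Fin (k + 4)) := by
          rw [Fin.succ_last, Fin.last_add_one]
        have h1 : i + 1 + 1 + Fin.last (k + 2) = i + 1 := by
          rw [add_assoc, add_comm 1, Fin.last_add_one, add_zero]
        rw [h0]
        simp [g, h1, Sym2.eq_swap]
      · have h0 : j.castSucc.succ + 1 = (j.castSucc + 1).succ := by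
          rw [Fin.coeSucc_eq_succ, Fin.succ_castSucc, Fin.coeSucc_eq_succ]
        rw [h0]
        simp [g, add_assoc]
  refine ⟨⟨g, hg⟩, rainbow_cycleGraph_of_injective c g ?_⟩
  have hlast : ∀ j : Fin (k + 2), i + 1 + 1 + j.castSucc ≠ i + 1 := by
    intro j hj
    rw [add_assoc, add_eq_left, add_comm 1, Fin.coeSucc_eq_succ] at hj
    exact Fin.succ_ne_zero _ hj
  rw [hcol, Fin.cons_injective_iff, Fin.snoc_injective_iff]
  refine ⟨?_, fun a b hab => ?_, ?_⟩
  · rintro ⟨j, hj⟩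
    revert hj
    refine Fin.lastCases (fun hj => ?_) (fun j hj => ?_) j
    · rw [Fin.snoc_last] at hj
      exact h hj
    · rw [Fin.snoc_castSucc] at hj
      rcases touch hj.symm with hp | hp
      · rw [← hp] at hj
        exact hr hj.symm
      · exact hlast j (add_right_cancel hp).symm
  · exact Fin.castSucc_injective _ (add_left_cancel (hf hab))
  · rintro ⟨j, hj⟩
    dsimp only at hj
    rcases touch hj.symm with hp | hp
    · exact hlast j hp.symm
    · rw [← hp, ← add_right_cancel hp] at hj
      exact hl hj.symm

/-- If `v` is a centre of two colour classes, then any rainbow cycle spanning the other vertices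
extends to a rainbow cycle through `v`. -/
theorem IsStarColouring.hasRainbowCopy_of_centre {α : Type*} {k : ℕ} {c : EdgeColouring α}
    (hc : IsStarColouring c) {v : α} (f : Fin (k + 3) ↪ α) (hfv : ∀ i, f i ≠ v)
    (hsurj : ∀ w, w ≠ v → ∃ i, f i = w)
    (hf : Function.Injective fun i => c s(f i, f (i + 1)))
    {m₁ m₂ : ℕ} (hm : m₁ ≠ m₂) (h₁ : IsCentre c v m₁) (h₂ : IsCentre c v m₂) :
    HasRainbowCopy c (cycleGraph (k + 4)) := by
  have succ_ne : ∀ j : Fin (k + 3), f j ≠ f (j + 1) := fun j hj => by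
    simpa using f.injective hj
  have spoke : ∀ {m}, IsCentre c v m → ∃ p, c s(v, f p) = m := by
    rintro m ⟨⟨e, hd, he, w, rfl⟩, -⟩
    obtain ⟨p, rfl⟩ := hsurj w fun hw => hd hw.symm
    exact ⟨p, he⟩
  have avoid : ∀ {m}, IsCentre c v m → ∀ j, c s(f j, f (j + 1)) ≠ m := by
    intro m hmc j hj
    rcases Sym2.mem_iff.1 (hmc.2 _ (succ_ne j) hj) with h | h
    · exact hfv _ h.symm
    · exact hfv _ h.symm
  by_contra hno
  have fail : ∀ i : Fin (k + 3), c s(v, f i) = c s(v, f (i + 1)) ∨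
      c s(v, f i) = c s(f (i - 1), f i) ∨
      c s(v, f (i + 1)) = c s(f (i + 1), f (i + 1 + 1)) := by
    intro i
    by_contra! h
    have e1 : i - 1 + 1 = i := sub_add_cancel i 1
    refine hno (hc.hasRainbowCopy_of_insert f hfv hf (i - 1) ?_ ?_ ?_)
    all_goals simp only [e1]
    exacts [h.1, h.2.1, h.2.2]
  have avoid_pred : ∀ {m}, IsCentre c v m → ∀ i, c s(f (i - 1), f i) ≠ m := by
    intro m hmc i
    simpa using avoid hmc (i - 1)
  obtain ⟨p, hp⟩ := spoke h₁
  obtain ⟨q, hq⟩ := spoke h₂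
  have hR : ∀ i, c s(v, f i) ≠ c s(f i, f (i + 1)) := by
    intro i hi
    have hall := Fin.forall_of_add_one (P := fun i => c s(v, f i) = c s(f i, f (i + 1)))
      (fun i hi => ?_) hi p
    · exact avoid h₁ p (hall.symm.trans hp)
    rcases fail i with h | h | h
    · exact (hc.2 _ _ _ (hfv i).symm (succ_ne i) (hfv (i + 1)).symm ⟨hi, hi.symm.trans h⟩).elim
    · have : i = i - 1 := hf (by simpa using hi.symm.trans h)
      exact (one_ne_zero (sub_eq_self.1 this.symm)).elim
    · exact h
  refine hm ((Fin.forall_of_add_one (P := fun i => c s(v, f i) = m₁)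
    (fun i hi => ?_) hp q).symm.trans hq)
  rcases fail i with h | h | h
  · exact h.symm.trans hi
  · exact (avoid_pred h₁ i (h.symm.trans hi)).elim
  · exact (hR _ h).elim

/-- Let `n ≥ 4`, let `c` be a star-colouring of `K_n` and `v` a vertex. If `v` is a
centre of at least two colour classes and the restriction of `c` to `K_n - v`
contains a rainbow Hamilton cycle `C_{n-1}`, then `c` has a rainbow Hamilton
cycle `C_n`. -/
theorem rainbow_hamilton_extension (n : ℕ) (hn : 4 ≤ n)
    (c : EdgeColouring (Fin n)) (hc : IsStarColouring c) (v : Fin n)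
    (hv : ∃ m₁ m₂ : ℕ, m₁ ≠ m₂ ∧ IsCentre c v m₁ ∧ IsCentre c v m₂)
    (hcyc : ∃ f : Fin (n - 1) ↪ Fin n, (∀ i, f i ≠ v) ∧
      ∀ u w x y : Fin (n - 1), (SimpleGraph.cycleGraph (n - 1)).Adj u w →
        (SimpleGraph.cycleGraph (n - 1)).Adj x y → s(u, w) ≠ s(x, y) →
        c s(f u, f w) ≠ c s(f x, f y)) :
    HasRainbowCopy c (SimpleGraph.cycleGraph n) := by
  obtain ⟨k, rfl⟩ := Nat.exists_eq_add_of_le' hn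
  obtain ⟨m₁, m₂, hm, h₁, h₂⟩ := hv
  obtain ⟨f, hfv, hf⟩ := hcyc
  have hinj : Function.Injective (Fin.cons v f : Fin (k + 4) → Fin (k + 4)) :=
    Fin.cons_injective_iff.2 ⟨fun ⟨i, hi⟩ => hfv i hi, f.injective⟩
  refine hc.hasRainbowCopy_of_centre f hfv (fun w hw => ?_)
    (injective_of_rainbow_cycleGraph c f hf) hm h₁ h₂
  obtain ⟨i, rfl⟩ := Finite.surjective_of_injective hinj w
  revert hw
  exact Fin.cases (fun hw => (hw rfl).elim) (fun i _ => ⟨i, rfl⟩) i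
end
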